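/- Let p ∈ (1,∞), let Ω₁ ⊂ Ω₂ ⊆ ℝ^d be domains with Ω₂ ∖ closure(Ω₁) ≠ ∅, and let V ∈ L^∞_loc(Ω₂) be real-valued. (1) If Q_V(u) ≥ 0 for all u ∈ C_c^∞(Ω₂), then Q_V is subcritical in Ω₁. (2) If Q_V is critical in Ω₁, then Q_V is supercritical in Ω₂, i.e., there exists u ∈ C_c^∞(Ω₂) with Q_V(u) < 0. -/

import Mathlib

open MeasureTheory Filter
open scoped Topology RealInnerProductSpace

noncomputable section

abbrev Ed (d : ℕ) := EuclideanSpace ℝ (Fin d)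

/-- A smooth test function compactly supported inside Ω. -/
def IsTestOn {d : ℕ} (Ω : Set (Ed d)) (u : Ed d → ℝ) : Prop :=
  ContDiff ℝ (⊤ : ℕ∞) u ∧ HasCompactSupport u ∧ tsupport u ⊆ Ω

/-- `V ∈ L^∞_loc(Ω)`. -/
def LocBddOn {d : ℕ} (Ω : Set (Ed d)) (V : Ed d → ℝ) : Prop :=
  Measurable V ∧ ∀ K : Set (Ed d), IsCompact K → K ⊆ Ω →
    ∃ M : ℝ, ∀ᵐ x ∂(volume : Measure (Ed d)), x ∈ K → |V x| ≤ M

/-- The functional `Q_V(u) = ∫_Ω (|∇u|^p + V|u|^p) dx`. -/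
def Qp {d : ℕ} (p : ℝ) (Ω : Set (Ed d)) (V : Ed d → ℝ) (u : Ed d → ℝ) : ℝ :=
  ∫ x in Ω, (‖gradient u x‖ ^ p + V x * |u x| ^ p)

/-- `Q_V` is nonnegative in Ω. -/
def NonnegOn {d : ℕ} (p : ℝ) (Ω : Set (Ed d)) (V : Ed d → ℝ) : Prop :=
  ∀ u, IsTestOn Ω u → 0 ≤ Qp p Ω V u

/-- `Q_V` is subcritical (strictly positive) in Ω: there is a continuous function
`W > 0` on Ω with `Q_V(u) ≥ ∫_Ω W|u|^p` for all test functions `u`. -/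
def SubcriticalOn {d : ℕ} (p : ℝ) (Ω : Set (Ed d)) (V : Ed d → ℝ) : Prop :=
  ∃ W : Ed d → ℝ, ContinuousOn W Ω ∧ (∀ x ∈ Ω, 0 < W x) ∧
    ∀ u, IsTestOn Ω u → (∫ x in Ω, W x * |u x| ^ p) ≤ Qp p Ω V u

/-- A null sequence for `Q_V` in Ω. -/
def NullSeqOn {d : ℕ} (p : ℝ) (Ω : Set (Ed d)) (V : Ed d → ℝ)
    (un : ℕ → Ed d → ℝ) : Prop :=
  (∀ n, IsTestOn Ω (un n)) ∧ (∀ n x, 0 ≤ un n x) ∧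
  (∃ B : Set (Ed d), IsOpen B ∧ IsCompact (closure B) ∧ closure B ⊆ Ω ∧
    ∀ n, (∫ x in B, |un n x| ^ p) = 1) ∧
  Tendsto (fun n => Qp p Ω V (un n)) atTop (𝓝 0)

/-- A ground state of `Q_V` in Ω: a positive C¹ function on Ω that is the limit of
a null sequence in `L^p(K)` for every compact `K ⊆ Ω`. -/
def IsGroundStateOn {d : ℕ} (p : ℝ) (Ω : Set (Ed d)) (V : Ed d → ℝ)
    (φ : Ed d → ℝ) : Prop :=
  ContDiffOn ℝ 1 φ Ω ∧ (∀ x ∈ Ω, 0 < φ x) ∧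
  ∃ un, NullSeqOn p Ω V un ∧ ∀ K : Set (Ed d), IsCompact K → K ⊆ Ω →
    Tendsto (fun n => ∫ x in K, |un n x - φ x| ^ p) atTop (𝓝 0)

/-- `Q_V` is critical in Ω. -/
def CriticalOn {d : ℕ} (p : ℝ) (Ω : Set (Ed d)) (V : Ed d → ℝ) : Prop :=
  NonnegOn p Ω V ∧ ∃ φ, IsGroundStateOn p Ω V φ

/-- A positive weak supersolution of `-Δ_p v + V|v|^{p-2}v = 0` in Ω. -/
def IsSupersolOn {d : ℕ} (p : ℝ) (Ω : Set (Ed d)) (V : Ed d → ℝ)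
    (v : Ed d → ℝ) : Prop :=
  ContDiffOn ℝ 1 v Ω ∧ (∀ x ∈ Ω, 0 < v x) ∧
  ∀ φ, IsTestOn Ω φ → (∀ x, 0 ≤ φ x) →
    0 ≤ ∫ x in Ω, (‖gradient v x‖ ^ (p - 2) * ⟪gradient v x, gradient φ x⟫ +
      V x * v x ^ (p - 1) * φ x)

/-- A positive weak solution of `-Δ_p v + V|v|^{p-2}v = 0` in Ω. -/
def IsSolOn {d : ℕ} (p : ℝ) (Ω : Set (Ed d)) (V : Ed d → ℝ)
    (v : Ed d → ℝ) : Prop :=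
  ContDiffOn ℝ 1 v Ω ∧ (∀ x ∈ Ω, 0 < v x) ∧
  ∀ φ, IsTestOn Ω φ →
    (∫ x in Ω, (‖gradient v x‖ ^ (p - 2) * ⟪gradient v x, gradient φ x⟫ +
      V x * v x ^ (p - 1) * φ x)) = 0


lemma seg_bound {d : ℕ} {p : ℝ} (hp : 1 < p) {f : Ed d → ℝ} (hf : ContDiff ℝ 1 f) (a b : Ed d) :
    ‖f a - f b‖ₑ ^ p ≤ ‖a - b‖ₑ ^ p *
      ∫⁻ s in Set.Ioc (0:ℝ) 1, ‖fderiv ℝ f (b + s • (a - b))‖ₑ ^ p := by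
  have hp0 : 0 < p := by linarith
  have hc : Continuous (fun s : ℝ => fderiv ℝ f (b + s • (a - b))) :=
    (hf.continuous_fderiv (by simp)).comp (by fun_prop)
  have h1 : ∫ s in (0:ℝ)..1, fderiv ℝ f (b + s • (a - b)) (a - b) = f a - f b := by
    have := intervalIntegral.integral_eq_sub_of_hasDerivAt (a := (0:ℝ)) (b := 1)
      (f := fun s : ℝ => f (b + s • (a - b)))
      (f' := fun s => fderiv ℝ f (b + s • (a - b)) (a - b)) (fun s _ => by
        have h2 := (hf.differentiable (by simp) (b + s • (a - b))).hasFDerivAt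
        have h3 : HasDerivAt (fun s : ℝ => b + s • (a - b)) (a - b) s := by
          simpa using ((hasDerivAt_id s).smul_const (a - b)).const_add b
        exact h2.comp_hasDerivAt s h3) (by
        apply Continuous.intervalIntegrable
        exact hc.clm_apply continuous_const)
    simpa using this
  rw [intervalIntegral.integral_of_le zero_le_one] at h1
  have h2 : ‖f a - f b‖ₑ ≤ ‖a - b‖ₑ * ∫⁻ s in Set.Ioc (0:ℝ) 1, ‖fderiv ℝ f (b + s • (a - b))‖ₑ := by
    rw [← h1, ← lintegral_const_mul _ hc.measurable.enorm]
    refine (enorm_integral_le_lintegral_enorm _).trans (lintegral_mono fun s => ?_)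
    rw [mul_comm]
    exact ContinuousLinearMap.le_opENorm _ _
  have h3 : (∫⁻ s in Set.Ioc (0:ℝ) 1, ‖fderiv ℝ f (b + s • (a - b))‖ₑ) ^ p ≤
      ∫⁻ s in Set.Ioc (0:ℝ) 1, ‖fderiv ℝ f (b + s • (a - b))‖ₑ ^ p := by
    have : IsProbabilityMeasure (volume.restrict (Set.Ioc (0:ℝ) 1)) := ⟨by simp⟩
    rw [lintegral_rpow_enorm_eq_rpow_eLpNorm' hp0]
    apply ENNReal.rpow_le_rpow _ hp0.le
    have := eLpNorm'_le_eLpNorm'_of_exponent_le (p := 1) (q := p) one_pos hp.le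
      (volume.restrict (Set.Ioc (0:ℝ) 1)) (f := fun s : ℝ => fderiv ℝ f (b + s • (a - b)))
      hc.aestronglyMeasurable
    simpa [eLpNorm'] using this
  calc _ ≤ (‖a - b‖ₑ * ∫⁻ s in Set.Ioc (0:ℝ) 1, ‖fderiv ℝ f (b + s • (a - b))‖ₑ) ^ p :=
        ENNReal.rpow_le_rpow h2 hp0.le
    _ = _ := ENNReal.mul_rpow_of_nonneg _ _ hp0.le
    _ ≤ _ := by gcongr

lemma dil_bound {d : ℕ} {h : Ed d → ENNReal} (hh : Measurable h) {x : Ed d} {r : ℝ} {s : ℝ}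
    (hs : 1 / 2 ≤ s) (hs1 : s ≤ 1) {b : Ed d} (hb : b ∈ Metric.ball x r) :
    ∫⁻ a in Metric.ball x r, h (b + s • (a - b)) ≤ 2 ^ d * ∫⁻ a in Metric.ball x r, h a := by
  have hs0 : s ≠ 0 := by linarith
  set k : Ed d → ENNReal := (Metric.ball x r).indicator h with hk
  have hkm : Measurable k := hh.indicator measurableSet_ball
  have h1 : ∫⁻ a in Metric.ball x r, h (b + s • (a - b)) ≤ ∫⁻ a, k ((1 - s) • b + s • a) := by
    rw [← lintegral_indicator measurableSet_ball]
    refine lintegral_mono fun a => ?_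
    by_cases ha : a ∈ Metric.ball x r
    · rw [Set.indicator_of_mem ha]
      have h2 : (1 - s) • b + s • a ∈ Metric.ball x r :=
        convex_ball x r hb ha (by linarith) (by linarith) (by ring)
      rw [hk, Set.indicator_of_mem h2]
      apply le_of_eq; congr 1; module
    · rw [Set.indicator_of_notMem ha]; exact zero_le
  refine h1.trans ?_
  have h3 : ∫⁻ a, k ((1 - s) • b + s • a) = ∫⁻ a, k ((1 - s) • b + a) ∂(Measure.map (fun x : Ed d => s • x) volume) := by
    rw [lintegral_map (by fun_prop) (by fun_prop)]
  rw [h3, Measure.map_addHaar_smul _ hs0, lintegral_smul_measure, lintegral_add_left_eq_self k,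
    hk, lintegral_indicator measurableSet_ball, smul_eq_mul]
  gcongr
  rw [abs_inv, finrank_euclideanSpace_fin, abs_of_nonneg (by positivity)]
  rw [show (2:ENNReal)^d = ENNReal.ofReal (2^d) by rw [ENNReal.ofReal_pow (by norm_num)]; simp]
  apply ENNReal.ofReal_le_ofReal
  rw [← inv_pow]
  gcongr
  rw [inv_le_comm₀ (by linarith) (by norm_num)]; linarith

lemma poincare {d : ℕ} {p : ℝ} (hp : 1 < p) {f : Ed d → ℝ} (hf : ContDiff ℝ 1 f)
    (x : Ed d) {r : ℝ} (hr : 0 < r) :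
    ∫⁻ a in Metric.ball x r, ∫⁻ b in Metric.ball x r, ‖f a - f b‖ₑ ^ p ≤
      ENNReal.ofReal ((2 * r) ^ p * 2 ^ d) * volume (Metric.ball x r) *
      ∫⁻ a in Metric.ball x r, ‖fderiv ℝ f a‖ₑ ^ p := by
  have hp0 : 0 < p := by linarith
  set B := Metric.ball x r with hB
  set h : Ed d → ENNReal := fun a => ‖fderiv ℝ f a‖ₑ ^ p with hh
  have hhm : Measurable h := by
    have := (hf.continuous_fderiv (by simp)).measurable.enorm
    exact this.pow_const p
  have h1 : ∀ a ∈ B, ∀ b ∈ B, ‖f a - f b‖ₑ ^ p ≤ ENNReal.ofReal ((2 * r) ^ p) *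
      ∫⁻ s in Set.Ioc (0:ℝ) 1, h (b + s • (a - b)) := by
    intro a ha b hb
    refine (seg_bound hp hf a b).trans ?_
    gcongr
    rw [← ENNReal.ofReal_rpow_of_nonneg (by positivity) hp0.le]
    gcongr
    rw [← ofReal_norm]
    apply ENNReal.ofReal_le_ofReal
    rw [← dist_eq_norm]
    have := dist_triangle_right a b x
    rw [hB, Metric.mem_ball] at ha hb
    linarith
  have key : ∀ s ∈ Set.Ioc (0:ℝ) 1, ∫⁻ a in B, ∫⁻ b in B, h (b + s • (a - b)) ≤
      2 ^ d * volume B * ∫⁻ a in B, h a := by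
    intro s hs
    by_cases h12 : 1 / 2 ≤ s
    · rw [lintegral_lintegral_swap]
      · calc _ ≤ ∫⁻ b in B, 2 ^ d * ∫⁻ a in B, h a := by
              apply setLIntegral_mono' measurableSet_ball
              intro b hb
              exact dil_bound hhm h12 hs.2 hb
          _ = _ := by rw [setLIntegral_const]; ring
      · apply Measurable.aemeasurable
        exact hhm.comp (by fun_prop)
    · calc _ ≤ ∫⁻ b in B, 2 ^ d * ∫⁻ a in B, h a := by
              apply setLIntegral_mono' measurableSet_ball
              intro a ha
              have := dil_bound hhm (x := x) (r := r) (s := 1 - s) (by linarith) (by linarith [hs.1]) ha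
              refine le_trans (le_of_eq ?_) this
              apply lintegral_congr; intro b; congr 1; module
          _ = _ := by rw [setLIntegral_const]; ring
  have hm3 : Measurable (fun z : Ed d × Ed d × ℝ => h (z.2.1 + z.2.2 • (z.1 - z.2.1))) :=
    hhm.comp (by fun_prop)
  calc _ ≤ ∫⁻ a in B, ∫⁻ b in B, ENNReal.ofReal ((2 * r) ^ p) *
      ∫⁻ s in Set.Ioc (0:ℝ) 1, h (b + s • (a - b)) := by
        apply setLIntegral_mono' measurableSet_ball
        intro a ha
        apply setLIntegral_mono' measurableSet_ball
        intro b hb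
        exact h1 a ha b hb
    _ = ENNReal.ofReal ((2 * r) ^ p) * ∫⁻ a in B, ∫⁻ s in Set.Ioc (0:ℝ) 1, ∫⁻ b in B, h (b + s • (a - b)) := by
        rw [← lintegral_const_mul' _ _ ENNReal.ofReal_ne_top]
        apply lintegral_congr; intro a
        rw [lintegral_const_mul' _ _ ENNReal.ofReal_ne_top]
        rw [lintegral_lintegral_swap]
        apply Measurable.aemeasurable
        exact hhm.comp (by fun_prop)
    _ = ENNReal.ofReal ((2 * r) ^ p) * ∫⁻ s in Set.Ioc (0:ℝ) 1, ∫⁻ a in B, ∫⁻ b in B, h (b + s • (a - b)) := by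
        congr 1
        rw [lintegral_lintegral_swap]
        apply Measurable.aemeasurable
        have : Measurable (fun z : (Ed d × ℝ) × Ed d => h (z.2 + z.1.2 • (z.1.1 - z.2))) :=
          hhm.comp (by fun_prop)
        exact this.lintegral_prod_right'
    _ ≤ ENNReal.ofReal ((2 * r) ^ p) * ∫⁻ s in Set.Ioc (0:ℝ) 1, 2 ^ d * volume B * ∫⁻ a in B, h a := by
        exact mul_le_mul' le_rfl (setLIntegral_mono' measurableSet_Ioc key)
    _ = _ := by
        rw [setLIntegral_const]
        rw [ENNReal.ofReal_mul (by positivity), ENNReal.ofReal_pow (by norm_num)]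
        simp
        ring

lemma st_deriv_bdd : ∃ L : ℝ, 0 < L ∧ ∀ x, |deriv Real.smoothTransition x| ≤ L := by
  have hc : Continuous (deriv Real.smoothTransition) :=
    (Real.smoothTransition.contDiff (n := 1)).continuous_deriv (by simp)
  obtain ⟨C, hC⟩ := (isCompact_Icc (a := (0:ℝ)) (b := 1)).exists_bound_of_continuousOn hc.continuousOn
  refine ⟨max C 1, by positivity, fun x => ?_⟩
  by_cases hx : x ∈ Set.Icc (0:ℝ) 1
  · exact (hC x hx).trans (le_max_left _ _)
  · have h0 : deriv Real.smoothTransition x = 0 := by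
      rw [Set.mem_Icc, not_and_or, not_le, not_le] at hx
      rcases hx with hx | hx
      · have : Real.smoothTransition =ᶠ[𝓝 x] fun _ => 0 := by
          filter_upwards [gt_mem_nhds hx] with y hy
          exact Real.smoothTransition.zero_of_nonpos (le_of_lt hy)
        rw [this.deriv_eq]; simp
      · have : Real.smoothTransition =ᶠ[𝓝 x] fun _ => 1 := by
          filter_upwards [lt_mem_nhds hx] with y hy
          exact Real.smoothTransition.one_of_one_le (le_of_lt hy)
        rw [this.deriv_eq]; simp
    rw [h0]; simp

lemma exists_bump (d : ℕ) : ∃ L : ℝ, 0 < L ∧ ∀ (x : Ed d) (r R : ℝ), 0 < r → r < R →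
    ∃ b : Ed d → ℝ, ContDiff ℝ (⊤ : ℕ∞) b ∧ (∀ y, 0 ≤ b y) ∧ (∀ y, b y ≤ 1) ∧
      (∀ y ∈ Metric.closedBall x r, b y = 1) ∧ (∀ y, y ∉ Metric.ball x R → b y = 0) ∧
      ∀ y, ‖fderiv ℝ b y‖ ≤ L / (R - r) := by
  obtain ⟨L, hL, hL2⟩ := st_deriv_bdd
  refine ⟨2 * L, by positivity, fun x r R hr hR => ?_⟩
  have hden : 0 < R ^ 2 - r ^ 2 := by nlinarith
  set g : Ed d → ℝ := fun y => (R ^ 2 - r ^ 2)⁻¹ * (R ^ 2 - ‖y - x‖ ^ 2) with hg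
  have hgs : ContDiff ℝ (⊤ : ℕ∞) g := by
    have : ContDiff ℝ (⊤ : ℕ∞) (fun y : Ed d => ‖y - x‖ ^ 2) :=
      (contDiff_id.sub contDiff_const).norm_sq ℝ
    exact contDiff_const.mul (contDiff_const.sub this)
  have hb0 : ∀ y, y ∉ Metric.ball x R → Real.smoothTransition (g y) = 0 := by
    intro y hy
    apply Real.smoothTransition.zero_of_nonpos
    rw [Metric.mem_ball, not_lt, dist_eq_norm] at hy
    apply mul_nonpos_of_nonneg_of_nonpos (by positivity)
    nlinarith
  refine ⟨fun y => Real.smoothTransition (g y), Real.smoothTransition.contDiff.comp hgs,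
    fun y => Real.smoothTransition.nonneg _, fun y => Real.smoothTransition.le_one _, ?_, hb0, ?_⟩
  · intro y hy
    apply Real.smoothTransition.one_of_one_le
    rw [Metric.mem_closedBall, dist_eq_norm] at hy
    rw [hg]; simp only
    rw [inv_mul_eq_div, le_div_iff₀ hden]
    nlinarith [norm_nonneg (y - x)]
  · intro y
    have hpos : 0 < R - r := by linarith
    by_cases hy : y ∈ Metric.closedBall x R
    · have h1 : HasFDerivAt g ((R ^ 2 - r ^ 2)⁻¹ • (-((2:ℕ) • (innerSL ℝ (y - x) : Ed d →L[ℝ] ℝ)))) y := by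
        have h2 : HasFDerivAt (fun y : Ed d => y - x) (ContinuousLinearMap.id ℝ (Ed d)) y :=
          (hasFDerivAt_id y).sub_const x
        have h3 := h2.norm_sq
        have := (h3.const_sub (R ^ 2)).const_mul ((R ^ 2 - r ^ 2)⁻¹)
        rw [ContinuousLinearMap.comp_id] at this
        exact this
      have h2 : HasDerivAt Real.smoothTransition (deriv Real.smoothTransition (g y)) (g y) :=
        ((Real.smoothTransition.contDiff (n := 1)).differentiable (by simp) _).hasDerivAt
      have h3 := h2.comp_hasFDerivAt y h1
      have h4 : fderiv ℝ (fun y => Real.smoothTransition (g y)) y = _ := h3.fderiv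
      rw [h4, norm_smul, norm_smul, norm_neg, Real.norm_eq_abs, Real.norm_eq_abs,
        abs_of_pos (inv_pos.2 hden)]
      have h5 : ‖(2:ℕ) • (innerSL ℝ (y - x) : Ed d →L[ℝ] ℝ)‖ ≤ 2 * R := by
        rw [← Nat.cast_smul_eq_nsmul ℝ, norm_smul, innerSL_apply_norm]
        rw [Metric.mem_closedBall, dist_eq_norm] at hy
        simp; linarith
      calc _ ≤ L * ((R ^ 2 - r ^ 2)⁻¹ * (2 * R)) := by
            gcongr; exact hL2 _
        _ ≤ 2 * L / (R - r) := by
            rw [show R ^ 2 - r ^ 2 = (R - r) * (R + r) by ring]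
            rw [inv_mul_eq_div, ← mul_div_assoc, div_le_div_iff₀ (by nlinarith) hpos]
            have : 0 < L * (R - r) := by positivity
            nlinarith
    · have : (fun y => Real.smoothTransition (g y)) =ᶠ[𝓝 y] fun _ => 0 := by
        have h1 : (Metric.closedBall x R)ᶜ ∈ 𝓝 y :=
          Metric.isClosed_closedBall.isOpen_compl.mem_nhds hy
        filter_upwards [h1] with z hz
        exact hb0 z (fun h => hz (Metric.ball_subset_closedBall h))
      rw [this.fderiv_eq]; simp; positivity


lemma convex2 {p : ℝ} (hp : 1 < p) {x y a b : ℝ} (hx : 0 ≤ x) (hy : 0 ≤ y) (ha : 0 ≤ a)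
    (hb : 0 ≤ b) (hab : a + b = 1) : (a * x + b * y) ^ p ≤ a * x ^ p + b * y ^ p :=
  (convexOn_rpow hp.le).2 hx hy ha hb hab

lemma conv1 {p : ℝ} (hp : 1 < p) {m : ℕ} (hm : p ≤ m) {b A X : ℝ} (hb : 0 ≤ b) (hb1 : b ≤ 1)
    (hA : 0 ≤ A) (hX : 0 ≤ X) :
    ((1 - b ^ m) * A + b ^ (m - 1) * X) ^ p ≤ (1 - b ^ m) * A ^ p + X ^ p := by
  have hm2 : 2 ≤ m := by
    have : (1:ℝ) < m := by linarith
    have : 1 < m := by exact_mod_cast this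
    omega
  have hXp : 0 ≤ X ^ p := by positivity
  rcases hb.eq_or_lt with h0 | hb0
  · rw [← h0, zero_pow (by omega), zero_pow (by omega)]
    simp; exact hXp
  · have hz : b ^ m ≤ 1 := pow_le_one₀ hb hb1
    have h1 := convex2 hp (x := A) (y := X / b) hA (by positivity)
      (a := 1 - b ^ m) (b := b ^ m) (by linarith) (by positivity) (by ring)
    have e1 : b ^ m * (X / b) = b ^ (m - 1) * X := by
      obtain ⟨k, rfl⟩ : ∃ k, m = k + 1 := ⟨m - 1, by omega⟩
      rw [Nat.add_sub_cancel, pow_succ]; field_simp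
    rw [e1] at h1
    refine h1.trans ?_
    gcongr
    rw [Real.div_rpow hX hb, ← mul_div_assoc, div_le_iff₀ (by positivity), mul_comm]
    gcongr
    rw [← Real.rpow_natCast]
    exact Real.rpow_le_rpow_of_exponent_ge hb0 hb1 hm

lemma logpt1 {p : ℝ} (hp : 1 < p) {m : ℕ} (hm : p ≤ m) {b A X v t : ℝ} (hb : 0 ≤ b) (hb1 : b ≤ 1)
    (hA : 0 ≤ A) (hX : 0 ≤ X) (hv : 0 < v) (ht : 0 < t) :
    ((v ^ p + t * b ^ m) ^ (1 / p - 1) * (v ^ (p - 1) * A + t * b ^ (m - 1) * X)) ^ p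
      ≤ A ^ p + t * X ^ p := by
  have hp0 : 0 < p := by linarith
  have hm2 : 2 ≤ m := by
    have : (1:ℝ) < m := by linarith
    have : 1 < m := by exact_mod_cast this
    omega
  have hXp : 0 ≤ X ^ p := by positivity
  have hvp : 0 < v ^ p := by positivity
  rcases hb.eq_or_lt with h0 | hb0
  · rw [← h0, zero_pow (by omega), zero_pow (by omega)]
    have e : (v ^ p + t * 0) ^ (1 / p - 1) * (v ^ (p - 1) * A + t * 0 * X) = A := by
      simp only [mul_zero, add_zero, zero_mul]
      rw [← Real.rpow_mul hv.le, ← mul_assoc, ← Real.rpow_add hv]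
      rw [show p * (1 / p - 1) + (p - 1) = 0 by field_simp; ring]
      simp
    rw [e]
    have : 0 ≤ t * X ^ p := by positivity
    linarith
  · set S := v ^ p + t * b ^ m with hS
    have hSp : 0 < S := by positivity
    set W := S ^ (1 / p) with hW
    have hWp : 0 < W := by positivity
    have hWS : W ^ p = S := by
      rw [hW, ← Real.rpow_mul hSp.le]; simp [hp0.ne']
    have h1 := convex2 hp (x := W / v * A) (y := W * X / b) (by positivity)
      (by positivity)
      (a := v ^ p / S) (b := t * b ^ m / S) (by positivity) (by positivity)
      (by rw [← add_div, ← hS, div_self hSp.ne'])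
    have hSW : S ^ (1 / p - 1) = W / S := by
      rw [Real.rpow_sub_one hSp.ne']
    have e1 : v ^ p / S * (W / v * A) + t * b ^ m / S * (W * X / b) =
        S ^ (1 / p - 1) * (v ^ (p - 1) * A + t * b ^ (m - 1) * X) := by
      rw [hSW, Real.rpow_sub_one hv.ne']
      obtain ⟨k, rfl⟩ : ∃ k, m = k + 1 := ⟨m - 1, by omega⟩
      rw [Nat.add_sub_cancel, pow_succ]; field_simp
    rw [e1] at h1
    refine h1.trans ?_
    rw [Real.mul_rpow (by positivity) hA, Real.div_rpow hWp.le hv.le, Real.div_rpow (by positivity) hb,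
      Real.mul_rpow hWp.le hX, hWS]
    have e2 : v ^ p / S * (S / v ^ p * A ^ p) = A ^ p := by field_simp
    have e3 : t * b ^ m / S * (S * X ^ p / b ^ p) = t * X ^ p * (b ^ m / b ^ p) := by
      field_simp
    rw [e2, e3]
    have : b ^ m / b ^ p ≤ 1 := by
      rw [div_le_one (by positivity), ← Real.rpow_natCast]
      exact Real.rpow_le_rpow_of_exponent_ge hb0 hb1 hm
    have h5 : 0 ≤ t * X ^ p := by positivity
    nlinarith

/-- the gain constant -/
def c0 (p : ℝ) : ℝ := min 1 (p - 1) * (2 ^ (p + 1))⁻¹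

lemma c0_pos {p : ℝ} (hp : 1 < p) : 0 < c0 p := by
  unfold c0
  have : 0 < min 1 (p - 1) := lt_min one_pos (by linarith)
  positivity

lemma logpt2 {p : ℝ} (hp : 1 < p) {A v t a κ : ℝ} (hA : 0 ≤ A) (hv : 0 < v) (ht : 0 < t)
    (ha : 0 ≤ a) (hκt : κ ^ p ≤ t) (hva : v ≤ a + κ) :
    ((v ^ p + t) ^ (1 / p - 1) * (v ^ (p - 1) * A)) ^ p
      ≤ A ^ p - c0 p * (t / (a ^ p + t) * A ^ p) := by
  have hp0 : 0 < p := by linarith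
  have hvp : 0 < v ^ p := by positivity
  have hap : 0 ≤ a ^ p := by positivity
  have hS : 0 < v ^ p + t := by positivity
  set S := v ^ p + t with hSdef
  have hAp : 0 ≤ A ^ p := by positivity
  have e1 : (S ^ (1 / p - 1) * (v ^ (p - 1) * A)) ^ p = (v ^ p / S) ^ (p - 1) * A ^ p := by
    rw [Real.mul_rpow (by positivity) (by positivity), Real.mul_rpow (by positivity) hA,
      ← Real.rpow_mul hS.le, ← Real.rpow_mul hv.le, Real.div_rpow hvp.le hS.le, ← Real.rpow_mul hv.le,
      show (1 / p - 1) * p = -(p - 1) by field_simp; ring, Real.rpow_neg hS.le,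
      mul_comm (p - 1) p]
    field_simp
  set θ := v ^ p / S with hθ
  have hθ0 : 0 < θ := by positivity
  have hθ1 : θ ≤ 1 := by rw [hθ, div_le_one hS]; linarith
  have h2 : θ ^ (p - 1) ≤ 1 - min 1 (p - 1) * (1 - θ) := by
    rcases le_total 1 (p - 1) with h | h
    · rw [min_eq_left h]
      have := Real.rpow_le_rpow_of_exponent_ge hθ0 hθ1 h
      rw [Real.rpow_one] at this
      linarith
    · rw [min_eq_right h]
      have := rpow_one_add_le_one_add_mul_self (s := θ - 1) (by linarith) (p := p - 1) (by linarith) h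
      rw [show 1 + (θ - 1) = θ by ring] at this
      linarith
  have h3 : v ^ p ≤ 2 ^ p * (a ^ p + t) := by
    calc v ^ p ≤ (2 * max a κ) ^ p := by
          apply Real.rpow_le_rpow hv.le _ hp0.le
          rcases le_total a κ with h | h
          · rw [max_eq_right h]; linarith
          · rw [max_eq_left h]; linarith
      _ = 2 ^ p * (max a κ) ^ p := by
          rw [Real.mul_rpow (by norm_num) (le_max_of_le_left ha)]
      _ ≤ _ := by
          gcongr
          rcases le_total a κ with h | h
          · rw [max_eq_right h]; linarith
          · rw [max_eq_left h]; linarith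
  have h4 : (2 ^ (p + 1))⁻¹ * (t / (a ^ p + t)) ≤ 1 - θ := by
    have : 1 - θ = t / S := by rw [hθ]; field_simp; rw [hSdef]; ring
    rw [this, inv_mul_eq_div, div_div]
    apply div_le_div_of_nonneg_left ht.le hS
    rw [Real.rpow_add (by norm_num), Real.rpow_one]
    have : (1:ℝ) ≤ 2 ^ p := Real.one_le_rpow (by norm_num) hp0.le
    nlinarith
  have hmin : 0 < min 1 (p - 1) := lt_min one_pos (by linarith)
  rw [e1]
  have h5 : θ ^ (p - 1) ≤ 1 - c0 p * (t / (a ^ p + t)) := by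
    unfold c0
    refine h2.trans ?_
    rw [mul_assoc]
    have := mul_le_mul_of_nonneg_left h4 hmin.le
    linarith
  nlinarith [mul_le_mul_of_nonneg_right h5 hAp]

def qV {d : ℕ} (p : ℝ) (V u : Ed d → ℝ) : ℝ :=
  ∫ x, (‖fderiv ℝ u x‖ ^ p + V x * |u x| ^ p)

lemma norm_grad {d : ℕ} (u : Ed d → ℝ) (x : Ed d) : ‖gradient u x‖ = ‖fderiv ℝ u x‖ := by
  simp [gradient]

lemma Qp_eq {d : ℕ} {p : ℝ} (hp : 1 < p) {Ω : Set (Ed d)} {V u : Ed d → ℝ}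
    (hu : IsTestOn Ω u) : Qp p Ω V u = qV p V u := by
  unfold Qp qV
  simp only [norm_grad]
  apply setIntegral_eq_integral_of_forall_compl_eq_zero
  intro x hx
  have hx' : x ∉ tsupport u := fun h => hx (hu.2.2 h)
  rw [image_eq_zero_of_notMem_tsupport hx', fderiv_of_notMem_tsupport ℝ hx']
  simp [Real.zero_rpow (by linarith : p ≠ 0)]

lemma absp_cont {d : ℕ} {p : ℝ} (hp : 1 < p) {u : Ed d → ℝ} (hu : Continuous u) :
    Continuous (fun x => |u x| ^ p) :=
  hu.abs.rpow_const (fun x => Or.inr (by linarith))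

lemma absp_supp {d : ℕ} {p : ℝ} (hp : 1 < p) {u : Ed d → ℝ} (hu : HasCompactSupport u) :
    HasCompactSupport (fun x => |u x| ^ p) :=
  hu.comp_left (g := fun y : ℝ => |y| ^ p) (by simp [Real.zero_rpow (by linarith : p ≠ 0)])

lemma int_absp {d : ℕ} {p : ℝ} (hp : 1 < p) {u : Ed d → ℝ} (hu : Continuous u)
    (hs : HasCompactSupport u) : Integrable (fun x => |u x| ^ p) :=
  (absp_cont hp hu).integrable_of_hasCompactSupport (absp_supp hp hs)

lemma gradp_cont {d : ℕ} {p : ℝ} (hp : 1 < p) {u : Ed d → ℝ} (hu : ContDiff ℝ (⊤ : ℕ∞) u) :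
    Continuous (fun x => ‖fderiv ℝ u x‖ ^ p) :=
  (hu.continuous_fderiv (by simp)).norm.rpow_const (fun x => Or.inr (by linarith))

lemma int_gradp {d : ℕ} {p : ℝ} (hp : 1 < p) {u : Ed d → ℝ} (hu : ContDiff ℝ (⊤ : ℕ∞) u)
    (hs : HasCompactSupport u) : Integrable (fun x => ‖fderiv ℝ u x‖ ^ p) :=
  (gradp_cont hp hu).integrable_of_hasCompactSupport
    ((hs.fderiv (𝕜 := ℝ)).comp_left (g := fun y : Ed d →L[ℝ] ℝ => ‖y‖ ^ p)
      (by simp [Real.zero_rpow (by linarith : p ≠ 0)]))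

lemma int_V {d : ℕ} {Ω : Set (Ed d)} {V g : Ed d → ℝ} (hV : LocBddOn Ω V)
    (hg : Continuous g) (hs : HasCompactSupport g) (hsub : tsupport g ⊆ Ω) :
    Integrable (fun x => V x * g x) := by
  obtain ⟨M, hM⟩ := hV.2 _ hs hsub
  have hi : Integrable (fun x => M * |g x|) :=
    (hg.integrable_of_hasCompactSupport hs).abs.const_mul M
  refine hi.mono' (hV.1.mul hg.measurable).aestronglyMeasurable ?_
  filter_upwards [hM] with x hx
  by_cases h : x ∈ tsupport g
  · rw [Real.norm_eq_abs, abs_mul]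
    exact mul_le_mul_of_nonneg_right (hx h) (abs_nonneg _)
  · rw [image_eq_zero_of_notMem_tsupport h]; simp

lemma int_Vu {d : ℕ} {p : ℝ} (hp : 1 < p) {Ω : Set (Ed d)} {V u : Ed d → ℝ} (hV : LocBddOn Ω V)
    (hu : IsTestOn Ω u) : Integrable (fun x => V x * |u x| ^ p) := by
  apply int_V hV (absp_cont hp hu.1.continuous) (absp_supp hp hu.2.1)
  refine subset_trans (closure_mono ?_) hu.2.2
  intro x hx h
  apply hx
  simp [h, Real.zero_rpow (by linarith : p ≠ 0)]

lemma fderiv_zero_of_zero {d : ℕ} {b : Ed d → ℝ} (hb : ∀ y, 0 ≤ b y) {x : Ed d} (hx : b x = 0) :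
    fderiv ℝ b x = 0 :=
  IsLocalMin.fderiv_eq_zero (Eventually.of_forall fun y => by rw [hx]; exact hb y)

lemma fderiv_zero_of_one {d : ℕ} {b : Ed d → ℝ} (hb : ∀ y, b y ≤ 1) {x : Ed d} (hx : b x = 1) :
    fderiv ℝ b x = 0 :=
  IsLocalMax.fderiv_eq_zero (Eventually.of_forall fun y => by rw [hx]; exact hb y)

lemma cacc {d : ℕ} {p : ℝ} (hp : 1 < p) {m : ℕ} (hm : p ≤ m) {Ω : Set (Ed d)} {V u b : Ed d → ℝ}
    (hV : LocBddOn Ω V) (hQ : ∀ w, IsTestOn Ω w → 0 ≤ qV p V w) (hu : IsTestOn Ω u)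
    (hbs : ContDiff ℝ (⊤ : ℕ∞) b) (hb0 : ∀ y, 0 ≤ b y) (hb1 : ∀ y, b y ≤ 1)
    {x : Ed d} {r R M L : ℝ} (hbr : ∀ y ∈ Metric.ball x r, b y = 1)
    (hbR : ∀ y, y ∉ Metric.closedBall x R → b y = 0) (hbL : ∀ y, ‖fderiv ℝ b y‖ ≤ L)
    (hVM : ∀ᵐ y ∂(volume : Measure (Ed d)), y ∈ Metric.closedBall x R → |V y| ≤ M) :
    ∫ y in Metric.ball x r, ‖fderiv ℝ u y‖ ^ p ≤
      qV p V u + ((m * L) ^ p + M) * ∫ y in Metric.closedBall x R, |u y| ^ p := by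
  have hp0 : 0 < p := by linarith
  have hL : 0 ≤ L := (norm_nonneg _).trans (hbL x)
  set w : Ed d → ℝ := fun y => (1 - b y ^ m) * u y with hw
  have hws : ContDiff ℝ (⊤ : ℕ∞) w := (contDiff_const.sub (hbs.pow m)).mul hu.1
  have hwt : IsTestOn Ω w := by
    refine ⟨hws, hu.2.1.mul_left, subset_trans (closure_mono ?_) hu.2.2⟩
    intro y hy h
    exact hy (by simp [hw, h])
  have h0 := hQ w hwt
  have i1 := int_gradp hp hu.1 hu.2.1
  have i2 := int_Vu hp hV hu
  have i3 := int_absp hp hu.1.continuous hu.2.1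
  have i4 : Integrable ((Metric.ball x r).indicator (fun y => ‖fderiv ℝ u y‖ ^ p)) :=
    i1.indicator measurableSet_ball
  have i5 : Integrable ((Metric.closedBall x R).indicator (fun y => |u y| ^ p)) :=
    i3.indicator measurableSet_closedBall
  rw [← integral_indicator measurableSet_ball, ← integral_indicator measurableSet_closedBall]
  have key : qV p V w ≤ ∫ y, ((‖fderiv ℝ u y‖ ^ p + V y * |u y| ^ p)
      - (Metric.ball x r).indicator (fun y => ‖fderiv ℝ u y‖ ^ p) y
      + ((m * L) ^ p + M) * (Metric.closedBall x R).indicator (fun y => |u y| ^ p) y) := by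
    refine integral_mono_ae ((int_gradp hp hws hwt.2.1).add (int_Vu hp hV hwt))
      (((i1.add i2).sub i4).add (i5.const_mul _)) ?_
    filter_upwards [hVM] with y hy
    have hfd : fderiv ℝ w y = (1 - b y ^ m) • fderiv ℝ u y
        - (u y * (m * b y ^ (m - 1))) • fderiv ℝ b y := by
      have h1 := (hbs.differentiable (by simp) y).hasFDerivAt
      have h2 := (hu.1.differentiable (by simp) y).hasFDerivAt
      have h3 := ((h1.pow m).const_sub 1).mul h2
      have h4 : fderiv ℝ w y = _ := h3.fderiv
      rw [h4]
      ext z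
      simp
      ring
    have hbm : b y ^ m ≤ 1 := pow_le_one₀ (hb0 y) (hb1 y)
    have hbm0 : 0 ≤ b y ^ m := pow_nonneg (hb0 y) m
    have hn : ‖fderiv ℝ w y‖ ≤ (1 - b y ^ m) * ‖fderiv ℝ u y‖
        + b y ^ (m - 1) * (m * ‖fderiv ℝ b y‖ * |u y|) := by
      rw [hfd]
      refine (norm_sub_le _ _).trans ?_
      rw [norm_smul, norm_smul, Real.norm_eq_abs, Real.norm_eq_abs, abs_of_nonneg (by linarith),
        abs_mul, abs_of_nonneg (mul_nonneg (Nat.cast_nonneg m) (pow_nonneg (hb0 y) (m-1)))]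
      apply le_of_eq; ring
    have h1 : ‖fderiv ℝ w y‖ ^ p ≤ (1 - b y ^ m) * ‖fderiv ℝ u y‖ ^ p + (m * ‖fderiv ℝ b y‖ * |u y|) ^ p :=
      (Real.rpow_le_rpow (norm_nonneg _) hn hp0.le).trans
        (conv1 hp hm (hb0 y) (hb1 y) (norm_nonneg _) (by positivity))
    have hA : 0 ≤ ‖fderiv ℝ u y‖ ^ p := by positivity
    have hU : 0 ≤ |u y| ^ p := by positivity
    have h2 : (1 - b y ^ m) * ‖fderiv ℝ u y‖ ^ p ≤ ‖fderiv ℝ u y‖ ^ p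
        - (Metric.ball x r).indicator (fun y => ‖fderiv ℝ u y‖ ^ p) y := by
      by_cases hyr : y ∈ Metric.ball x r
      · rw [Set.indicator_of_mem hyr, hbr y hyr]; simp
      · rw [Set.indicator_of_notMem hyr]; nlinarith
    have hwu : |w y| ^ p = (1 - b y ^ m) ^ p * |u y| ^ p := by
      rw [hw, abs_mul, abs_of_nonneg (by linarith), Real.mul_rpow (by linarith) (abs_nonneg _)]
    have h3 : (m * ‖fderiv ℝ b y‖ * |u y|) ^ p + V y * |w y| ^ p ≤ V y * |u y| ^ p +
        ((m * L) ^ p + M) * (Metric.closedBall x R).indicator (fun y => |u y| ^ p) y := by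
      by_cases hyR : y ∈ Metric.closedBall x R
      · rw [Set.indicator_of_mem hyR, hwu, Real.mul_rpow (by positivity) (by positivity)]
        have h4 : (m * ‖fderiv ℝ b y‖) ^ p ≤ (m * L) ^ p := by
          gcongr; exact hbL y
        have h5 : 0 ≤ (1 - b y ^ m) ^ p := Real.rpow_nonneg (by linarith) p
        have h6 : (1 - b y ^ m) ^ p ≤ 1 := Real.rpow_le_one (by linarith) (by linarith) hp0.le
        have h7 := abs_le.1 (hy hyR)
        have h8 : V y * (1 - b y ^ m) ^ p ≤ V y + M := by nlinarith
        nlinarith [mul_le_mul_of_nonneg_right h4 hU, mul_le_mul_of_nonneg_right h8 hU]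
      · have hby := hbR y hyR
        rw [Set.indicator_of_notMem hyR, hwu, fderiv_zero_of_zero hb0 hby, hby,
          zero_pow (by rintro rfl; simp at hm; linarith)]
        simp [Real.zero_rpow hp0.ne']
    linarith
  have i6 : Integrable (fun y => ‖fderiv ℝ u y‖ ^ p + V y * |u y| ^ p) := i1.add i2
  have i7 : Integrable (fun y => ‖fderiv ℝ u y‖ ^ p + V y * |u y| ^ p
      - (Metric.ball x r).indicator (fun y => ‖fderiv ℝ u y‖ ^ p) y) := i6.sub i4
  rw [integral_add i7 (i5.const_mul _), integral_sub i6 i4, integral_const_mul] at key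
  unfold qV
  linarith



def wk {d : ℕ} (p : ℝ) (m : ℕ) (t κ : ℝ) (u b : Ed d → ℝ) (y : Ed d) : ℝ :=
  ((u y ^ 2 + κ ^ 2) ^ (p / 2) + t * b y ^ m) ^ (1 / p) - κ

lemma sq_rpow_half {p a : ℝ} (ha : 0 ≤ a) : a ^ (p / 2) = (Real.sqrt a) ^ p := by
  rw [Real.sqrt_eq_rpow, ← Real.rpow_mul ha]; congr 1; ring

lemma wk_test {d : ℕ} {p : ℝ} (hp : 1 < p) {m : ℕ} (hm : m ≠ 0) {t κ : ℝ} (ht : 0 < t) (hκ : 0 < κ)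
    {Ω : Set (Ed d)} {u b : Ed d → ℝ} (hu : IsTestOn Ω u) (hbs : ContDiff ℝ (⊤ : ℕ∞) b)
    (hb0 : ∀ y, 0 ≤ b y) {x : Ed d} {R : ℝ} (hbR : ∀ y, y ∉ Metric.closedBall x R → b y = 0)
    (hR : Metric.closedBall x R ⊆ Ω) :
    IsTestOn Ω (wk p m t κ u b) ∧ ∀ y, y ∉ tsupport u ∪ Metric.closedBall x R → wk p m t κ u b y = 0 := by
  have hp0 : 0 < p := by linarith
  have hz : ∀ y, y ∉ tsupport u ∪ Metric.closedBall x R → wk p m t κ u b y = 0 := by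
    intro y hy
    rw [Set.mem_union, not_or] at hy
    unfold wk
    rw [image_eq_zero_of_notMem_tsupport hy.1, hbR y hy.2, zero_pow hm]
    rw [sq_rpow_half (by positivity)]
    simp only [ne_eq, OfNat.ofNat_ne_zero, not_false_eq_true, zero_pow, zero_add, mul_zero, add_zero]
    rw [Real.sqrt_sq hκ.le, one_div, Real.rpow_rpow_inv hκ.le hp0.ne', sub_self]
  have hK : IsCompact (tsupport u ∪ Metric.closedBall x R) :=
    hu.2.1.isCompact.union (isCompact_closedBall x R)
  refine ⟨⟨?_, HasCompactSupport.intro hK hz, ?_⟩, hz⟩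
  · unfold wk
    refine ContDiff.sub (ContDiff.rpow_const_of_ne (ContDiff.add (ContDiff.rpow_const_of_ne
      ((hu.1.pow 2).add contDiff_const) ?_) (contDiff_const.mul (hbs.pow m))) ?_) contDiff_const
    · intro y; positivity
    · intro y
      have := hb0 y
      positivity
  · refine (closure_minimal ?_ hK.isClosed).trans (Set.union_subset hu.2.2 hR)
    intro y hy
    by_contra h
    exact hy (hz y h)

lemma wk_grad {d : ℕ} {p : ℝ} (hp : 1 < p) {m : ℕ} {t κ : ℝ} (ht : 0 < t) (hκ : 0 < κ)
    {u b : Ed d → ℝ} (hu : ContDiff ℝ (⊤ : ℕ∞) u) (hbs : ContDiff ℝ (⊤ : ℕ∞) b)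
    (hb0 : ∀ y, 0 ≤ b y) (y : Ed d) :
    ‖fderiv ℝ (wk p m t κ u b) y‖ ≤
      ((Real.sqrt (u y ^ 2 + κ ^ 2)) ^ p + t * b y ^ m) ^ (1 / p - 1) *
      ((Real.sqrt (u y ^ 2 + κ ^ 2)) ^ (p - 1) * ‖fderiv ℝ u y‖
        + t * b y ^ (m - 1) * (m / p * ‖fderiv ℝ b y‖)) := by
  have hp0 : 0 < p := by linarith
  have hby := hb0 y
  have h1 := (hbs.differentiable (by simp) y).hasFDerivAt
  have h2 := (hu.differentiable (by simp) y).hasFDerivAt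
  have hpos : 0 < u y ^ 2 + κ ^ 2 := by positivity
  have h3 := (((h2.pow 2).add_const (κ ^ 2)).rpow_const (p := p / 2) (Or.inl hpos.ne'))
  have h4 := h3.add ((h1.pow m).const_mul t)
  have hS : 0 < (u y ^ 2 + κ ^ 2) ^ (p / 2) + t * b y ^ m := by positivity
  have h5 := (h4.rpow_const (p := 1 / p) (Or.inl hS.ne')).sub_const κ
  have h6 : fderiv ℝ (wk p m t κ u b) y = _ := h5.fderiv
  set v := Real.sqrt (u y ^ 2 + κ ^ 2) with hv
  have hv0 : 0 < v := by rw [hv]; positivity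
  have hvs : v ^ 2 = u y ^ 2 + κ ^ 2 := Real.sq_sqrt hpos.le
  have huv : |u y| ≤ v := by
    rw [hv]; apply Real.abs_le_sqrt; nlinarith
  have e1 : (u y ^ 2 + κ ^ 2) ^ (p / 2) = v ^ p := sq_rpow_half hpos.le
  have e2 : (u y ^ 2 + κ ^ 2) ^ (p / 2 - 1) = v ^ (p - 2) := by
    rw [← sq_rpow_half hpos.le]; congr 1; ring
  have h7 : fderiv ℝ (wk p m t κ u b) y = (v ^ p + t * b y ^ m) ^ (1 / p - 1) •
      ((u y * v ^ (p - 2)) • fderiv ℝ u y + (t * b y ^ (m - 1) * (m / p)) • fderiv ℝ b y) := by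
    rw [h6]
    ext z
    simp only [Pi.add_apply, e1, e2]
    simp
    field_simp
  rw [h7, norm_smul, Real.norm_of_nonneg (by positivity)]
  gcongr
  refine (norm_add_le _ _).trans ?_
  rw [norm_smul, norm_smul, Real.norm_of_nonneg (by positivity : 0 ≤ t * b y ^ (m - 1) * (m / p)),
    mul_assoc (t * b y ^ (m - 1))]
  gcongr
  rw [norm_mul, Real.norm_eq_abs, Real.norm_of_nonneg (by positivity)]
  rw [show p - 1 = 1 + (p - 2) by ring, Real.rpow_add hv0, Real.rpow_one]
  gcongr

lemma wk_pt {d : ℕ} {p : ℝ} (hp : 1 < p) {m : ℕ} (hm : p ≤ m) {u b : Ed d → ℝ}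
    (hu : ContDiff ℝ (⊤ : ℕ∞) u)
    (hbs : ContDiff ℝ (⊤ : ℕ∞) b) (hb0 : ∀ y, 0 ≤ b y) (hb1 : ∀ y, b y ≤ 1)
    {x : Ed d} {r R L : ℝ} (hbr : ∀ y ∈ Metric.ball x r, b y = 1)
    (hbR : ∀ y, y ∉ Metric.closedBall x R → b y = 0) (hbL : ∀ y, ‖fderiv ℝ b y‖ ≤ L)
    {t κ : ℝ} (ht : 0 < t) (hκ : 0 < κ) (hκt : κ ^ p ≤ t) (y : Ed d) :
    ‖fderiv ℝ (wk p m t κ u b) y‖ ^ p ≤ ‖fderiv ℝ u y‖ ^ p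
      - c0 p * (Metric.ball x r).indicator (fun y => t / (|u y| ^ p + t) * ‖fderiv ℝ u y‖ ^ p) y
      + (t * (m / p * L) ^ p) * (Metric.closedBall x R).indicator (fun _ => (1:ℝ)) y := by
  have hp0 : 0 < p := by linarith
  have hL : 0 ≤ L := (norm_nonneg _).trans (hbL x)
  have hpos : 0 < u y ^ 2 + κ ^ 2 := by positivity
  have hg := Real.rpow_le_rpow (norm_nonneg _) (wk_grad hp (m := m) ht hκ hu hbs hb0 y) hp0.le
  refine hg.trans ?_
  set v := Real.sqrt (u y ^ 2 + κ ^ 2) with hv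
  have hv0 : 0 < v := by rw [hv]; positivity
  have hva : v ≤ |u y| + κ := by
    rw [hv]; apply Real.sqrt_le_iff.2 ⟨by positivity, ?_⟩
    have := abs_nonneg (u y)
    nlinarith [sq_abs (u y)]
  have hI : 0 ≤ (t * (m / p * L) ^ p) * (Metric.closedBall x R).indicator (fun _ => (1:ℝ)) y := by
    apply mul_nonneg (by positivity)
    apply Set.indicator_nonneg; intros; norm_num
  by_cases hyr : y ∈ Metric.ball x r
  · have hby := hbr y hyr
    rw [Set.indicator_of_mem hyr, hby, fderiv_zero_of_one hb1 hby]
    have := logpt2 hp (norm_nonneg (fderiv ℝ u y)) hv0 ht (abs_nonneg (u y)) hκt hva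
    simp only [one_pow, mul_one, norm_zero, mul_zero, add_zero]
    linarith
  · rw [Set.indicator_of_notMem hyr]
    have := logpt1 hp hm (hb0 y) (hb1 y) (norm_nonneg (fderiv ℝ u y))
      (X := m / p * ‖fderiv ℝ b y‖) (by positivity) hv0 ht
    refine this.trans ?_
    by_cases hyR : y ∈ Metric.closedBall x R
    · rw [Set.indicator_of_mem hyR]
      have : t * (m / p * ‖fderiv ℝ b y‖) ^ p ≤ t * (m / p * L) ^ p := by
        gcongr; exact hbL y
      linarith
    · rw [fderiv_zero_of_zero hb0 (hbR y hyR)]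
      simp only [norm_zero, mul_zero, Real.zero_rpow hp0.ne']
      linarith

lemma wk_bd {d : ℕ} {p : ℝ} (hp : 1 < p) {m : ℕ} {t κ : ℝ} (ht : 0 < t) (hκ : 0 < κ)
    {u b : Ed d → ℝ} (hb0 : ∀ y, 0 ≤ b y) (y : Ed d) :
    0 ≤ wk p m t κ u b y ∧ (wk p m t κ u b y) ^ p ≤ (u y ^ 2 + κ ^ 2) ^ (p / 2) + t * b y ^ m := by
  have hp0 : 0 < p := by linarith
  have hby := hb0 y
  have hpos : 0 < u y ^ 2 + κ ^ 2 := by positivity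
  have h1 : κ ≤ ((u y ^ 2 + κ ^ 2) ^ (p / 2) + t * b y ^ m) ^ (1 / p) := by
    calc κ = (κ ^ p) ^ (1 / p) := by rw [one_div, Real.rpow_rpow_inv hκ.le hp0.ne']
      _ ≤ _ := by
        gcongr
        rw [sq_rpow_half hpos.le]
        have : κ ≤ Real.sqrt (u y ^ 2 + κ ^ 2) := Real.le_sqrt_of_sq_le (by nlinarith)
        have h2 := Real.rpow_le_rpow hκ.le this hp0.le
        have : 0 ≤ t * b y ^ m := by positivity
        linarith
  have h0 : 0 ≤ wk p m t κ u b y := by unfold wk; linarith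
  refine ⟨h0, ?_⟩
  have hS : 0 ≤ (u y ^ 2 + κ ^ 2) ^ (p / 2) + t * b y ^ m := by positivity
  calc (wk p m t κ u b y) ^ p ≤ (((u y ^ 2 + κ ^ 2) ^ (p / 2) + t * b y ^ m) ^ (1 / p)) ^ p := by
        apply Real.rpow_le_rpow h0 _ hp0.le
        unfold wk; linarith
    _ = _ := by rw [one_div, Real.rpow_inv_rpow hS hp0.ne']

lemma log_est {d : ℕ} {p : ℝ} (hp : 1 < p) {m : ℕ} (hm : p ≤ m) {Ω : Set (Ed d)} {V u b : Ed d → ℝ}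
    (hV : LocBddOn Ω V) (hQ : ∀ w, IsTestOn Ω w → 0 ≤ qV p V w) (hu : IsTestOn Ω u)
    (hbs : ContDiff ℝ (⊤ : ℕ∞) b) (hb0 : ∀ y, 0 ≤ b y) (hb1 : ∀ y, b y ≤ 1)
    {x : Ed d} {r R M L : ℝ} (hbr : ∀ y ∈ Metric.ball x r, b y = 1)
    (hbR : ∀ y, y ∉ Metric.closedBall x R → b y = 0) (hbL : ∀ y, ‖fderiv ℝ b y‖ ≤ L)
    (hR : Metric.closedBall x R ⊆ Ω)
    (hVM : ∀ᵐ y ∂(volume : Measure (Ed d)), y ∈ Metric.closedBall x R → |V y| ≤ M)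
    {t : ℝ} (ht : 0 < t) :
    c0 p * ∫ y in Metric.ball x r, t / (|u y| ^ p + t) * ‖fderiv ℝ u y‖ ^ p ≤
      qV p V u + t * ((m / p * L) ^ p + M) * (volume : Measure (Ed d)).real (Metric.closedBall x R) := by
  have hp0 : 0 < p := by linarith
  have hm0 : m ≠ 0 := by rintro rfl; simp at hm; linarith
  have hL : 0 ≤ L := (norm_nonneg _).trans (hbL x)
  set κ : ℕ → ℝ := fun n => t ^ (1 / p) / (n + 1) with hκd
  have hκ0 : ∀ n, 0 < κ n := fun n => by simp only [hκd]; positivity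
  have hκle : ∀ n, κ n ≤ t ^ (1 / p) := fun n => by
    simp only [hκd]
    apply div_le_self (by positivity)
    linarith [Nat.cast_nonneg (α := ℝ) n]
  have hκt : ∀ n, κ n ^ p ≤ t := fun n => by
    calc κ n ^ p ≤ (t ^ (1 / p)) ^ p := Real.rpow_le_rpow (hκ0 n).le (hκle n) hp0.le
      _ = t := by rw [one_div, Real.rpow_inv_rpow ht.le hp0.ne']
  have hκl : Tendsto κ atTop (𝓝 0) := by
    have := (tendsto_one_div_add_atTop_nhds_zero_nat (𝕜 := ℝ)).const_mul (t ^ (1 / p))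
    simp only [mul_zero] at this
    refine this.congr fun n => ?_
    simp only [hκd]; ring
  set K := tsupport u ∪ Metric.closedBall x R with hKd
  have hK : IsCompact K := hu.2.1.isCompact.union (isCompact_closedBall x R)
  obtain ⟨MK, hMK⟩ := hV.2 K hK (Set.union_subset hu.2.2 hR)
  have i1 := int_gradp hp hu.1 hu.2.1
  have i2 := int_Vu hp hV hu
  set gg : Ed d → ℝ := fun y => t / (|u y| ^ p + t) * ‖fderiv ℝ u y‖ ^ p with hgg
  have igg : Integrable gg := by
    refine i1.mono' ?_ (Eventually.of_forall fun y => ?_)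
    · apply Continuous.aestronglyMeasurable
      apply Continuous.mul _ (gradp_cont hp hu.1)
      apply Continuous.div continuous_const ((absp_cont hp hu.1.continuous).add continuous_const)
      intro y
      have : 0 < |u y| ^ p + t := by positivity
      exact this.ne'
    · simp only [hgg]
      rw [Real.norm_of_nonneg (by positivity)]
      have h1 : t / (|u y| ^ p + t) ≤ 1 := by
        rw [div_le_one (by positivity)]
        have : 0 ≤ |u y| ^ p := by positivity
        linarith
      have : 0 ≤ ‖fderiv ℝ u y‖ ^ p := by positivity
      nlinarith
  have i4 : Integrable ((Metric.ball x r).indicator gg) := igg.indicator measurableSet_ball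
  have i5 : Integrable ((Metric.closedBall x R).indicator (fun _ => (1:ℝ)) : Ed d → ℝ) := by
    rw [integrable_indicator_iff measurableSet_closedBall]
    exact integrableOn_const (measure_closedBall_lt_top.ne)
  set vol := (volume : Measure (Ed d)).real (Metric.closedBall x R) with hvol
  have e5 : ∫ y, (Metric.closedBall x R).indicator (fun _ => (1:ℝ)) y = vol := by
    rw [integral_indicator measurableSet_closedBall]; simp [hvol]
  have e4 : ∫ y, (Metric.ball x r).indicator gg y = ∫ y in Metric.ball x r, gg y :=
    integral_indicator measurableSet_ball
  set G := (∫ y, ‖fderiv ℝ u y‖ ^ p) - c0 p * (∫ y in Metric.ball x r, gg y)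
    + t * (m / p * L) ^ p * vol with hG
  have step : ∀ n, 0 ≤ G + ∫ y, V y * |wk p m t (κ n) u b y| ^ p := by
    intro n
    obtain ⟨hwt, -⟩ := wk_test hp hm0 ht (hκ0 n) hu hbs hb0 hbR hR
    have h0 := hQ _ hwt
    have j1 := int_gradp hp hwt.1 hwt.2.1
    have j2 := int_Vu hp hV hwt
    unfold qV at h0
    rw [integral_add j1 j2] at h0
    have i7 : Integrable (fun y => ‖fderiv ℝ u y‖ ^ p - c0 p * (Metric.ball x r).indicator gg y) :=
      i1.sub (i4.const_mul _)
    have hmono : ∫ y, ‖fderiv ℝ (wk p m t (κ n) u b) y‖ ^ p ≤ ∫ y, (‖fderiv ℝ u y‖ ^ p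
      - c0 p * (Metric.ball x r).indicator gg y
      + (t * (m / p * L) ^ p) * (Metric.closedBall x R).indicator (fun _ => (1:ℝ)) y) :=
      integral_mono j1 (i7.add (i5.const_mul _))
        (fun y => wk_pt hp hm hu.1 hbs hb0 hb1 hbr hbR hbL ht (hκ0 n) (hκt n) y)
    rw [integral_add i7 (i5.const_mul _), integral_sub i1 (i4.const_mul _), integral_const_mul,
      integral_const_mul, e4, e5] at hmono
    linarith
  -- limit
  obtain ⟨U, hU⟩ := hu.1.continuous.bounded_above_of_compact_support hu.2.1
  set κ0 := t ^ (1 / p) with hκ0d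
  set D := (U ^ 2 + κ0 ^ 2) ^ (p / 2) + t with hD
  have hlim : Tendsto (fun n => ∫ y, V y * |wk p m t (κ n) u b y| ^ p) atTop
      (𝓝 (∫ y, V y * (|u y| ^ p + t * b y ^ m))) := by
    refine tendsto_integral_of_dominated_convergence (K.indicator fun _ => MK * D) ?_ ?_ ?_ ?_
    · intro n
      obtain ⟨hwt, -⟩ := wk_test hp hm0 ht (hκ0 n) hu hbs hb0 hbR hR
      exact (int_Vu hp hV hwt).aestronglyMeasurable
    · rw [integrable_indicator_iff hK.measurableSet]
      exact integrableOn_const hK.measure_lt_top.ne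
    · intro n
      filter_upwards [hMK] with y hy
      by_cases hyK : y ∈ K
      · rw [Set.indicator_of_mem hyK, norm_mul, Real.norm_eq_abs]
        obtain ⟨hw0, hw1⟩ := wk_bd hp (m := m) (u := u) ht (hκ0 n) hb0 y
        rw [Real.norm_of_nonneg (by positivity), abs_of_nonneg hw0]
        refine mul_le_mul (hy hyK) (hw1.trans ?_) (by positivity) ((abs_nonneg _).trans (hy hyK))
        rw [hD]
        have hb' : b y ^ m ≤ 1 := pow_le_one₀ (hb0 y) (hb1 y)
        have hu' : u y ^ 2 ≤ U ^ 2 := sq_le_sq.2 ((hU y).trans (le_abs_self U))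
        have hk' : κ n ^ 2 ≤ κ0 ^ 2 := by
          have := hκle n; have := hκ0 n; gcongr
        have := Real.rpow_le_rpow (by positivity) (add_le_add hu' hk') (by positivity : 0 ≤ p / 2)
        nlinarith
      · rw [Set.indicator_of_notMem hyK, (wk_test hp hm0 ht (hκ0 n) hu hbs hb0 hbR hR).2 y hyK]
        simp [Real.zero_rpow hp0.ne']
    · refine Eventually.of_forall fun y => ?_
      apply Tendsto.const_mul
      have hby := hb0 y
      have c1 : ContinuousAt (fun k : ℝ => |((u y ^ 2 + k ^ 2) ^ (p / 2) + t * b y ^ m) ^ (1 / p) - k| ^ p) 0 := by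
        apply Continuous.continuousAt
        apply Continuous.rpow_const _ (fun _ => Or.inr hp0.le)
        apply Continuous.abs
        apply Continuous.sub _ continuous_id
        apply Continuous.rpow_const _ (fun _ => Or.inr (by positivity))
        apply Continuous.add _ continuous_const
        exact Continuous.rpow_const (by fun_prop) (fun _ => Or.inr (by positivity))
      have := c1.tendsto.comp hκl
      refine this.trans (le_of_eq ?_)
      congr 1
      have hS : 0 ≤ (u y ^ 2) ^ (p / 2) + t * b y ^ m := by positivity
      simp only [ne_eq, OfNat.ofNat_ne_zero, not_false_eq_true, zero_pow, add_zero, sub_zero]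
      rw [abs_of_nonneg (by positivity), one_div, Real.rpow_inv_rpow hS hp0.ne',
        sq_rpow_half (by positivity), Real.sqrt_sq_eq_abs]
  have hfin : 0 ≤ G + ∫ y, V y * (|u y| ^ p + t * b y ^ m) :=
    ge_of_tendsto (hlim.const_add G) (Eventually.of_forall step)
  have hts : ∀ y, y ∉ Metric.closedBall x R → b y ^ m = 0 := fun y hy => by
    rw [hbR y hy, zero_pow hm0]
  have ib : Integrable (fun y => V y * (b y ^ m)) := by
    refine int_V hV (hbs.continuous.pow m) (HasCompactSupport.intro (isCompact_closedBall x R) hts) ?_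
    refine (closure_minimal ?_ Metric.isClosed_closedBall).trans hR
    intro y hy; by_contra h; exact hy (hts y h)
  have e6 : ∫ y, V y * (|u y| ^ p + t * b y ^ m) = (∫ y, V y * |u y| ^ p) + t * ∫ y, V y * (b y ^ m) := by
    rw [← integral_const_mul, ← integral_add i2 (ib.const_mul t)]
    congr 1; ext y; ring
  have e7 : ∫ y, V y * (b y ^ m) ≤ M * vol := by
    rw [← e5, ← integral_const_mul]
    refine integral_mono_ae ib (i5.const_mul M) ?_
    filter_upwards [hVM] with y hy
    by_cases hyR : y ∈ Metric.closedBall x R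
    · rw [Set.indicator_of_mem hyR]
      have hb' : b y ^ m ≤ 1 := pow_le_one₀ (hb0 y) (hb1 y)
      have hb'' : 0 ≤ b y ^ m := pow_nonneg (hb0 y) m
      have := abs_le.1 (hy hyR)
      nlinarith [abs_nonneg (V y), hy hyR]
    · rw [Set.indicator_of_notMem hyR, hts y hyR]; simp
  have e8 : qV p V u = (∫ y, ‖fderiv ℝ u y‖ ^ p) + ∫ y, V y * |u y| ^ p := by
    unfold qV; exact integral_add i1 i2
  rw [e6] at hfin
  rw [e8]
  have := mul_le_mul_of_nonneg_left e7 ht.le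
  linarith



def om (d : ℕ) : ℝ := (volume : Measure (Ed d)).real (Metric.ball 0 1)

lemma om_pos (d : ℕ) : 0 < om d := by
  unfold om
  exact ENNReal.toReal_pos (Metric.measure_ball_pos _ _ one_pos).ne' measure_ball_lt_top.ne

lemma vol_ball {d : ℕ} (x : Ed d) {r : ℝ} (hr : 0 < r) :
    volume (Metric.ball x r) = ENNReal.ofReal (r ^ d * om d) := by
  rw [Measure.addHaar_ball_of_pos _ x hr, ENNReal.ofReal_mul (by positivity), om, ofReal_measureReal
    measure_ball_lt_top.ne]
  simp

lemma vol_cball {d : ℕ} (x : Ed d) {r : ℝ} (hr : 0 < r) :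
    volume (Metric.closedBall x r) = ENNReal.ofReal (r ^ d * om d) := by
  rw [Measure.addHaar_closedBall _ x hr.le, ENNReal.ofReal_mul (by positivity), om, ofReal_measureReal
    measure_ball_lt_top.ne]
  simp

lemma lint_absp {d : ℕ} {p : ℝ} (hp : 1 < p) {u : Ed d → ℝ} (hu : Continuous u)
    (hs : HasCompactSupport u) (B : Set (Ed d)) :
    ∫⁻ y in B, ‖u y‖ₑ ^ p = ENNReal.ofReal (∫ y in B, |u y| ^ p) := by
  rw [ofReal_integral_eq_lintegral_ofReal (int_absp hp hu hs).integrableOn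
    (Eventually.of_forall fun y => by positivity)]
  refine lintegral_congr fun y => ?_
  rw [← ofReal_norm, ENNReal.ofReal_rpow_of_nonneg (norm_nonneg _) (by linarith), Real.norm_eq_abs]

lemma lint_gradp {d : ℕ} {p : ℝ} (hp : 1 < p) {u : Ed d → ℝ} (hu : ContDiff ℝ (⊤ : ℕ∞) u)
    (hs : HasCompactSupport u) (B : Set (Ed d)) :
    ∫⁻ y in B, ‖fderiv ℝ u y‖ₑ ^ p = ENNReal.ofReal (∫ y in B, ‖fderiv ℝ u y‖ ^ p) := by
  rw [ofReal_integral_eq_lintegral_ofReal (int_gradp hp hu hs).integrableOn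
    (Eventually.of_forall fun y => by positivity)]
  refine lintegral_congr fun y => ?_
  rw [← ofReal_norm, ENNReal.ofReal_rpow_of_nonneg (norm_nonneg _) (by linarith)]

def Fl {d : ℕ} (p t : ℝ) (u : Ed d → ℝ) (y : Ed d) : ℝ := Real.log (1 + |u y| ^ p / t)

lemma Fl_nonneg {d : ℕ} {p t : ℝ} (ht : 0 < t) (u : Ed d → ℝ) (y : Ed d) : 0 ≤ Fl p t u y := by
  unfold Fl
  apply Real.log_nonneg
  have : 0 ≤ |u y| ^ p / t := by positivity
  linarith

lemma Fl_le {d : ℕ} {p t : ℝ} (ht : 0 < t) (u : Ed d → ℝ) (y : Ed d) :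
    Fl p t u y ≤ |u y| ^ p / t := by
  unfold Fl
  have h : 0 ≤ |u y| ^ p / t := by positivity
  have := Real.log_le_sub_one_of_pos (by linarith : 0 < 1 + |u y| ^ p / t)
  linarith

lemma Fl_smooth {d : ℕ} {p t : ℝ} (hp : 1 < p) (ht : 0 < t) {u : Ed d → ℝ} (hu : ContDiff ℝ 1 u) :
    ContDiff ℝ 1 (Fl p t u) := by
  unfold Fl
  simp_rw [← Real.norm_eq_abs]
  refine ContDiff.log (contDiff_const.add ((hu.norm_rpow hp).div_const t)) ?_
  intro y; positivity

lemma Fl_grad {d : ℕ} {p t : ℝ} (hp : 1 < p) (ht : 0 < t) {u : Ed d → ℝ} (hu : ContDiff ℝ 1 u) (y : Ed d) :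
    ‖fderiv ℝ (Fl p t u) y‖ ^ p ≤ p ^ p / t * (t / (|u y| ^ p + t) * ‖fderiv ℝ u y‖ ^ p) := by
  have hp0 : 0 < p := by linarith
  have hd : Differentiable ℝ u := hu.differentiable (by simp)
  have h1 := ((hd.norm_rpow hp) y).hasFDerivAt
  have hS : 0 < 1 + ‖u y‖ ^ p / t := by positivity
  have h2 := ((h1.const_mul t⁻¹).const_add 1).log (by
    have : 0 < 1 + t⁻¹ * ‖u y‖ ^ p := by positivity
    exact this.ne')
  have h3 : fderiv ℝ (Fl p t u) y = (1 + t⁻¹ * ‖u y‖ ^ p)⁻¹ • t⁻¹ • fderiv ℝ (fun x => ‖u x‖ ^ p) y := by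
    have : Fl p t u = fun y => Real.log (1 + t⁻¹ * ‖u y‖ ^ p) := by
      ext y; simp [Fl, Real.norm_eq_abs]; ring_nf
    rw [this]
    exact h2.fderiv
  have hT : 0 < |u y| ^ p + t := by positivity
  have h4 : ‖fderiv ℝ (Fl p t u) y‖ ≤ (|u y| ^ p + t)⁻¹ * (p * |u y| ^ (p - 1) * ‖fderiv ℝ u y‖) := by
    have h5 := norm_fderiv_norm_rpow_le hd (x := y) hp
    rw [h3, norm_smul, norm_smul, ← mul_assoc]
    rw [Real.norm_eq_abs (u y)] at *
    refine mul_le_mul (le_of_eq ?_) h5 (norm_nonneg _) (by positivity)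
    rw [Real.norm_of_nonneg (by positivity), Real.norm_of_nonneg (by positivity), ← mul_inv]
    congr 1; field_simp; ring
  refine (Real.rpow_le_rpow (norm_nonneg _) h4 hp0.le).trans ?_
  rw [Real.mul_rpow (by positivity) (by positivity), Real.mul_rpow (by positivity) (by positivity),
    Real.mul_rpow (by positivity) (by positivity)]
  have h6 : ((|u y| ^ p + t)⁻¹) ^ p * (|u y| ^ (p - 1)) ^ p ≤ (|u y| ^ p + t)⁻¹ := by
    rw [← Real.rpow_mul (abs_nonneg _), mul_comm (p - 1) p, Real.rpow_mul (abs_nonneg _),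
      Real.inv_rpow hT.le]
    have h7 : (|u y| ^ p) ^ (p - 1) ≤ (|u y| ^ p + t) ^ (p - 1) :=
      Real.rpow_le_rpow (by positivity) (by linarith) (by linarith)
    have h8 : (|u y| ^ p + t) ^ p = (|u y| ^ p + t) ^ (p - 1) * (|u y| ^ p + t) := by
      rw [← Real.rpow_add_one hT.ne']; congr 1; ring
    rw [h8]
    have h9 : 0 < (|u y| ^ p + t) ^ (p - 1) := by positivity
    rw [mul_inv, mul_comm, ← mul_assoc]
    apply mul_le_of_le_one_left (by positivity)
    rw [← div_eq_mul_inv, div_le_one h9]; exact h7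
  calc ((|u y| ^ p + t)⁻¹) ^ p * (p ^ p * (|u y| ^ (p - 1)) ^ p * ‖fderiv ℝ u y‖ ^ p)
      = (((|u y| ^ p + t)⁻¹) ^ p * (|u y| ^ (p - 1)) ^ p) * (p ^ p * ‖fderiv ℝ u y‖ ^ p) := by ring
    _ ≤ (|u y| ^ p + t)⁻¹ * (p ^ p * ‖fderiv ℝ u y‖ ^ p) := by gcongr
    _ = _ := by field_simp

lemma osc {d : ℕ} {p : ℝ} (hp : 1 < p) {Ω : Set (Ed d)} {V : Ed d → ℝ}
    (hV : LocBddOn Ω V) (hQ : ∀ w, IsTestOn Ω w → 0 ≤ qV p V w) {S M : ℝ} (hS : 0 < S) (hM : 0 ≤ M) :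
    ∃ C : ℝ, 0 ≤ C ∧ ∀ (x : Ed d) (r : ℝ) (u : Ed d → ℝ) (ε t : ℝ), 0 < r → r ≤ S →
      Metric.closedBall x (2 * r) ⊆ Ω →
      (∀ᵐ y ∂(volume : Measure (Ed d)), y ∈ Metric.closedBall x (2 * r) → |V y| ≤ M) →
      IsTestOn Ω u → qV p V u ≤ ε → 0 < t → ε / t * r ^ p ≤ r ^ d * om d →
      ∫⁻ a in Metric.ball x r, ∫⁻ b in Metric.ball x r, ‖Fl p t u a - Fl p t u b‖ₑ ≤
        ENNReal.ofReal C * (volume (Metric.ball x r) * volume (Metric.ball x r)) := by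
  have hp0 : 0 < p := by linarith
  obtain ⟨Lb, hLb, hbump⟩ := exists_bump d
  obtain ⟨m, hm⟩ := exists_nat_ge p
  set C1 : ℝ := p ^ p * (c0 p)⁻¹ * (1 + ((m / p * Lb) ^ p + M * S ^ p) * 2 ^ d) with hC1
  have hc0 := c0_pos hp
  have hC10 : 0 ≤ C1 := by positivity
  refine ⟨1 + 2 ^ p * 2 ^ d * C1, by positivity, ?_⟩
  intro x r u ε t hr hrS hsub hVM hu hε ht htr
  obtain ⟨b, hbs, hb0, hb1, hbr, hbR, hbL⟩ := hbump x r (2 * r) hr (by linarith)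
  have hle := log_est hp hm hV hQ hu hbs hb0 hb1 (x := x) (r := r) (R := 2 * r) (M := M) (L := Lb / r)
    (fun y hy => hbr y (Metric.ball_subset_closedBall hy))
    (fun y hy => hbR y (fun h => hy (Metric.ball_subset_closedBall h)))
    (fun y => by have := hbL y; rwa [show 2 * r - r = r by ring] at this) hsub hVM ht
  have hvol : (volume : Measure (Ed d)).real (Metric.closedBall x (2 * r)) = 2 ^ d * (r ^ d * om d) := by
    have := om_pos d
    rw [Measure.real, vol_cball x (by positivity), ENNReal.toReal_ofReal (by positivity)]; ring
  rw [hvol] at hle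
  set w := r ^ d * om d with hw
  have hw0 : 0 < w := by have := om_pos d; positivity
  set B := Metric.ball x r with hB
  set I := ∫ y in B, t / (|u y| ^ p + t) * ‖fderiv ℝ u y‖ ^ p with hI
  have hrp : 0 < r ^ p := by positivity
  have hI1 : r ^ p * (p ^ p / t * I) ≤ C1 * w := by
    have e1 : (m / p * (Lb / r)) ^ p = (m / p * Lb) ^ p / r ^ p := by
      rw [← mul_div_assoc, Real.div_rpow (by positivity) hr.le]
    rw [e1] at hle
    have h1 : I ≤ (c0 p)⁻¹ * (ε + t * ((m / p * Lb) ^ p / r ^ p + M) * (2 ^ d * w)) := by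
      rw [inv_mul_eq_div, le_div_iff₀ hc0]
      linarith
    have h2 : r ^ p ≤ S ^ p := Real.rpow_le_rpow hr.le hrS hp0.le
    calc r ^ p * (p ^ p / t * I) ≤ r ^ p * (p ^ p / t * ((c0 p)⁻¹ * (ε + t * ((m / p * Lb) ^ p / r ^ p + M) * (2 ^ d * w)))) := by gcongr
      _ = p ^ p * (c0 p)⁻¹ * (ε / t * r ^ p + ((m / p * Lb) ^ p + M * r ^ p) * 2 ^ d * w) := by
        field_simp
      _ ≤ p ^ p * (c0 p)⁻¹ * (w + ((m / p * Lb) ^ p + M * S ^ p) * 2 ^ d * w) := by gcongr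
      _ = C1 * w := by rw [hC1]; ring
  have hu1 : ContDiff ℝ 1 u := hu.1.of_le (by simp)
  have hF := Fl_smooth hp ht hu1
  have hgr : ∫⁻ a in B, ‖fderiv ℝ (Fl p t u) a‖ₑ ^ p ≤ ENNReal.ofReal (p ^ p / t * I) := by
    have i1 := int_gradp hp hu.1 hu.2.1
    have igg : Integrable (fun y => t / (|u y| ^ p + t) * ‖fderiv ℝ u y‖ ^ p) := by
      refine i1.mono' ?_ (Eventually.of_forall fun y => ?_)
      · apply Continuous.aestronglyMeasurable
        apply Continuous.mul _ (gradp_cont hp hu.1)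
        apply Continuous.div continuous_const ((absp_cont hp hu.1.continuous).add continuous_const)
        intro y
        have : 0 < |u y| ^ p + t := by positivity
        exact this.ne'
      · rw [Real.norm_of_nonneg (by positivity)]
        have h1 : t / (|u y| ^ p + t) ≤ 1 := by
          rw [div_le_one (by positivity)]
          have : 0 ≤ |u y| ^ p := by positivity
          linarith
        have : 0 ≤ ‖fderiv ℝ u y‖ ^ p := by positivity
        nlinarith
    rw [hI, ← integral_const_mul, ofReal_integral_eq_lintegral_ofReal
      (igg.const_mul _).integrableOn (Eventually.of_forall fun y => by positivity)]
    refine lintegral_mono fun y => ?_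
    rw [← ofReal_norm, ENNReal.ofReal_rpow_of_nonneg (norm_nonneg _) hp0.le]
    exact ENNReal.ofReal_le_ofReal (Fl_grad hp ht hu1 y)
  have hpo := poincare hp hF x hr
  rw [← hB] at hpo
  have hvB : volume B = ENNReal.ofReal w := vol_ball x hr
  have hfin : ∫⁻ a in B, ∫⁻ b in B, ‖Fl p t u a - Fl p t u b‖ₑ ^ p ≤
      ENNReal.ofReal (2 ^ p * 2 ^ d * C1 * (w * w)) := by
    refine hpo.trans ?_
    rw [hvB]
    calc _ ≤ ENNReal.ofReal ((2 * r) ^ p * 2 ^ d) * ENNReal.ofReal w * ENNReal.ofReal (p ^ p / t * I) := by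
          gcongr
      _ = ENNReal.ofReal (2 ^ p * 2 ^ d * w * (r ^ p * (p ^ p / t * I))) := by
          rw [← ENNReal.ofReal_mul (by positivity), ← ENNReal.ofReal_mul (by positivity),
            Real.mul_rpow (by norm_num) hr.le]
          congr 1; ring
      _ ≤ _ := by
          apply ENNReal.ofReal_le_ofReal
          calc _ ≤ 2 ^ p * 2 ^ d * w * (C1 * w) := by gcongr
            _ = _ := by ring
  have hpt : ∀ s : ENNReal, s ≤ 1 + s ^ p := by
    intro s
    rcases le_total s 1 with h | h
    · exact h.trans le_self_add
    · calc s = s ^ (1:ℝ) := by simp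
        _ ≤ s ^ p := ENNReal.rpow_le_rpow_of_exponent_le h hp.le
        _ ≤ _ := le_add_self
  calc ∫⁻ a in B, ∫⁻ b in B, ‖Fl p t u a - Fl p t u b‖ₑ
      ≤ ∫⁻ a in B, (volume B + ∫⁻ b in B, ‖Fl p t u a - Fl p t u b‖ₑ ^ p) := by
        refine lintegral_mono fun a => ?_
        calc _ ≤ ∫⁻ b in B, (1 + ‖Fl p t u a - Fl p t u b‖ₑ ^ p) := lintegral_mono fun b => hpt _
          _ = _ := by rw [lintegral_add_left measurable_const]; simp
    _ = volume B * volume B + ∫⁻ a in B, ∫⁻ b in B, ‖Fl p t u a - Fl p t u b‖ₑ ^ p := by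
        rw [lintegral_add_left measurable_const]; simp
    _ ≤ volume B * volume B + ENNReal.ofReal (2 ^ p * 2 ^ d * C1 * (w * w)) := by gcongr
    _ = _ := by
        rw [hvB, ← ENNReal.ofReal_mul hw0.le, ← ENNReal.ofReal_mul (by positivity),
          ← ENNReal.ofReal_add (by positivity) (by positivity)]
        congr 1; ring



lemma mean_step {d : ℕ} {F : Ed d → ℝ} (hF : Continuous F) (B' B : Set (Ed d)) :
    (∫⁻ a in B', ‖F a‖ₑ) * volume B ≤ volume B' * (∫⁻ b in B, ‖F b‖ₑ) +
      ∫⁻ a in B', ∫⁻ b in B, ‖F a - F b‖ₑ := by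
  have hm : Measurable (fun b => ‖F b‖ₑ) := hF.enorm.measurable
  calc (∫⁻ a in B', ‖F a‖ₑ) * volume B = ∫⁻ a in B', ∫⁻ _b in B, ‖F a‖ₑ := by
        rw [← lintegral_mul_const _ hm]; simp
    _ ≤ ∫⁻ a in B', ∫⁻ b in B, (‖F b‖ₑ + ‖F a - F b‖ₑ) := by
        refine lintegral_mono fun a => lintegral_mono fun b => ?_
        calc ‖F a‖ₑ = ‖F b + (F a - F b)‖ₑ := by congr 1; ring
          _ ≤ _ := enorm_add_le _ _
    _ = ∫⁻ a in B', ((∫⁻ b in B, ‖F b‖ₑ) + ∫⁻ b in B, ‖F a - F b‖ₑ) := by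
        refine lintegral_congr fun a => ?_
        rw [lintegral_add_left hm]
    _ = _ := by
        rw [lintegral_add_left measurable_const]; simp [mul_comm]

lemma mean_down {d : ℕ} {F : Ed d → ℝ} (hF : Continuous F) {B' B : Set (Ed d)} (hBB : B' ⊆ B)
    (hB0 : volume B ≠ 0) (hBt : volume B ≠ ⊤) {K C : ENNReal}
    (hK : ∫⁻ b in B, ‖F b‖ₑ ≤ K * volume B)
    (ho : ∫⁻ a in B, ∫⁻ b in B, ‖F a - F b‖ₑ ≤ C * (volume B * volume B)) :
    ∫⁻ a in B', ‖F a‖ₑ ≤ K * volume B' + C * volume B := by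
  have h := mean_step hF B' B
  have h1 : ∫⁻ a in B', ∫⁻ b in B, ‖F a - F b‖ₑ ≤ C * (volume B * volume B) :=
    (lintegral_mono_set hBB).trans ho
  rw [← ENNReal.mul_le_mul_iff_left hB0 hBt]
  calc _ ≤ _ := h
    _ ≤ volume B' * (K * volume B) + C * (volume B * volume B) := by gcongr
    _ = _ := by ring

lemma half_lem {d : ℕ} {p : ℝ} (hp : 1 < p) {u : Ed d → ℝ} (hu : ContDiff ℝ 1 u) (x : Ed d) {r : ℝ}
    (hr : 0 < r) {G : Set (Ed d)} (hG : G ⊆ Metric.ball x r) (hGm : MeasurableSet G)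
    (h2 : volume (Metric.ball x r) ≤ 2 * volume G) {k : ENNReal} (hk : ∀ y ∈ G, ‖u y‖ₑ ^ p ≤ k) :
    ∫⁻ y in Metric.ball x r, ‖u y‖ₑ ^ p ≤
      2 * 2 ^ p * ENNReal.ofReal ((2 * r) ^ p * 2 ^ d) * (∫⁻ y in Metric.ball x r, ‖fderiv ℝ u y‖ₑ ^ p)
        + 2 ^ p * k * volume (Metric.ball x r) := by
  have hp0 : 0 < p := by linarith
  set B := Metric.ball x r with hB
  have hB0 : volume B ≠ 0 := (Metric.measure_ball_pos _ _ hr).ne'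
  have hBt : volume B ≠ ⊤ := measure_ball_lt_top.ne
  have hG0 : volume G ≠ 0 := by
    intro h; rw [h] at h2; simp at h2; exact hB0 h2
  have hGt : volume G ≠ ⊤ := ne_top_of_le_ne_top hBt (measure_mono hG)
  have hum : Measurable (fun b => ‖u b‖ₑ ^ p) := hu.continuous.enorm.measurable.pow_const p
  have hpo := poincare hp hu x hr
  rw [← hB] at hpo
  rw [← ENNReal.mul_le_mul_iff_left hG0 hGt]
  have hpt : ∀ a b, ‖u a‖ₑ ^ p ≤ 2 ^ p * (‖u b‖ₑ ^ p + ‖u a - u b‖ₑ ^ p) := by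
    intro a b
    calc ‖u a‖ₑ ^ p ≤ (‖u b‖ₑ + ‖u a - u b‖ₑ) ^ p := by
          apply ENNReal.rpow_le_rpow _ hp0.le
          calc ‖u a‖ₑ = ‖u b + (u a - u b)‖ₑ := by congr 1; ring
            _ ≤ _ := enorm_add_le _ _
      _ ≤ (2 * max ‖u b‖ₑ ‖u a - u b‖ₑ) ^ p := by
          apply ENNReal.rpow_le_rpow _ hp0.le
          rw [two_mul]
          exact add_le_add (le_max_left _ _) (le_max_right _ _)
      _ = 2 ^ p * (max ‖u b‖ₑ ‖u a - u b‖ₑ) ^ p := by rw [ENNReal.mul_rpow_of_nonneg _ _ hp0.le]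
      _ ≤ _ := by
          gcongr
          rcases le_total ‖u b‖ₑ ‖u a - u b‖ₑ with h | h
          · rw [max_eq_right h]; exact le_add_self
          · rw [max_eq_left h]; exact le_self_add
  calc (∫⁻ a in B, ‖u a‖ₑ ^ p) * volume G = ∫⁻ a in B, ∫⁻ _b in G, ‖u a‖ₑ ^ p := by
        rw [← lintegral_mul_const _ hum]; simp
    _ ≤ ∫⁻ a in B, ∫⁻ b in G, 2 ^ p * (k + ‖u a - u b‖ₑ ^ p) := by
        refine lintegral_mono fun a => setLIntegral_mono' hGm fun b hb => ?_
        refine (hpt a b).trans ?_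
        gcongr
        exact hk b hb
    _ ≤ ∫⁻ a in B, (2 ^ p * (k * volume G) + 2 ^ p * ∫⁻ b in B, ‖u a - u b‖ₑ ^ p) := by
        refine lintegral_mono fun a => ?_
        have hmm : Measurable (fun b => ‖u a - u b‖ₑ ^ p) :=
          (continuous_const.sub hu.continuous).enorm.measurable.pow_const p
        have hmm2 : Measurable (fun b => k + ‖u a - u b‖ₑ ^ p) := measurable_const.add hmm
        rw [lintegral_const_mul _ hmm2, lintegral_add_left measurable_const,
          setLIntegral_const, mul_add]
        gcongr
    _ = 2 ^ p * (k * volume G) * volume B + 2 ^ p * ∫⁻ a in B, ∫⁻ b in B, ‖u a - u b‖ₑ ^ p := by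
        rw [lintegral_add_left measurable_const, setLIntegral_const, lintegral_const_mul']
        exact ENNReal.rpow_ne_top_of_nonneg hp0.le (by simp)
    _ ≤ 2 ^ p * (k * volume G) * volume B + 2 ^ p * (ENNReal.ofReal ((2 * r) ^ p * 2 ^ d) * volume B *
          ∫⁻ a in B, ‖fderiv ℝ u a‖ₑ ^ p) := by gcongr
    _ ≤ 2 ^ p * (k * volume G) * volume B + 2 ^ p * (ENNReal.ofReal ((2 * r) ^ p * 2 ^ d) * (2 * volume G) *
          ∫⁻ a in B, ‖fderiv ℝ u a‖ₑ ^ p) := by gcongr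
    _ = _ := by ring

lemma averaging {d : ℕ} {f g : Ed d → ENNReal} (hf : Measurable f) (hg : Measurable g) {z : Ed d} {ρ s : ℝ}
    (hs : 0 < s) {c e : ENNReal}
    (h : ∀ x ∈ Metric.ball z (ρ + s), ∫⁻ y in Metric.ball x s, f y ≤ c * (∫⁻ y in Metric.ball x s, g y) + e) :
    (∫⁻ y in Metric.closedBall z ρ, f y) * volume (Metric.ball z s) ≤
      c * (∫⁻ y in Metric.ball z (ρ + 2 * s), g y) * volume (Metric.ball z s) + e * volume (Metric.ball z (ρ + s)) := by
  have hvs : ∀ y : Ed d, volume (Metric.ball y s) = volume (Metric.ball z s) := fun y => by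
    rw [Measure.addHaar_ball_center, Measure.addHaar_ball_center _ z]
  set B := Metric.ball z (ρ + s) with hB
  have hT : MeasurableSet {q : Ed d × Ed d | dist q.2 q.1 < s} :=
    (isOpen_lt (by fun_prop) continuous_const).measurableSet
  have hconv : ∀ f : Ed d → ENNReal, Measurable f → ∫⁻ x in B, ∫⁻ y in Metric.ball x s, f y =
      ∫⁻ y, f y * volume (Metric.ball y s ∩ B) := by
    intro f hf
    have hmeas : Measurable (fun q : Ed d × Ed d =>
        {q : Ed d × Ed d | dist q.2 q.1 < s}.indicator (fun q => f q.2) q) :=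
      (hf.comp measurable_snd).indicator hT
    calc ∫⁻ x in B, ∫⁻ y in Metric.ball x s, f y
        = ∫⁻ x in B, ∫⁻ y, {q : Ed d × Ed d | dist q.2 q.1 < s}.indicator (fun q => f q.2) (x, y) := by
          refine lintegral_congr fun x => ?_
          rw [← lintegral_indicator measurableSet_ball]
          refine lintegral_congr fun y => ?_
          simp [Set.indicator, Metric.mem_ball]
      _ = ∫⁻ y, ∫⁻ x in B, {q : Ed d × Ed d | dist q.2 q.1 < s}.indicator (fun q => f q.2) (x, y) :=
          lintegral_lintegral_swap hmeas.aemeasurable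
      _ = _ := by
          refine lintegral_congr fun y => ?_
          have : ∀ x, {q : Ed d × Ed d | dist q.2 q.1 < s}.indicator (fun q => f q.2) (x, y)
              = (Metric.ball y s).indicator (fun _ => f y) x := by
            intro x; simp [Set.indicator, Metric.mem_ball, dist_comm]
          simp_rw [this]
          rw [lintegral_indicator measurableSet_ball, setLIntegral_const,
            Measure.restrict_apply measurableSet_ball]
  have h1 : ∫⁻ x in B, ∫⁻ y in Metric.ball x s, f y ≤
      c * (∫⁻ x in B, ∫⁻ y in Metric.ball x s, g y) + e * volume B := by
    calc _ ≤ ∫⁻ x in B, (c * (∫⁻ y in Metric.ball x s, g y) + e) :=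
          setLIntegral_mono' measurableSet_ball h
      _ = _ := by
          rw [lintegral_add_right _ measurable_const, setLIntegral_const, lintegral_const_mul]
          have hmeas : Measurable (fun q : Ed d × Ed d =>
            {q : Ed d × Ed d | dist q.2 q.1 < s}.indicator (fun q => g q.2) q) :=
            (hg.comp measurable_snd).indicator hT
          suffices hc : (fun x : Ed d => ∫⁻ y in Metric.ball x s, g y) = fun x => ∫⁻ y,
              {q : Ed d × Ed d | dist q.2 q.1 < s}.indicator (fun q => g q.2) (x, y) by
            rw [hc]; exact hmeas.lintegral_prod_right' (ν := (volume : Measure (Ed d)))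
          ext x
          rw [← lintegral_indicator measurableSet_ball]
          refine lintegral_congr fun y => ?_
          simp [Set.indicator, Metric.mem_ball]
  rw [hconv f hf, hconv g hg] at h1
  have h2 : (∫⁻ y in Metric.closedBall z ρ, f y) * volume (Metric.ball z s) ≤
      ∫⁻ y, f y * volume (Metric.ball y s ∩ B) := by
    rw [← lintegral_mul_const _ hf]
    refine le_trans ?_ (setLIntegral_le_lintegral (Metric.closedBall z ρ) _)
    refine setLIntegral_mono' measurableSet_closedBall fun y hy => ?_
    suffices hin : Metric.ball y s ⊆ B by rw [Set.inter_eq_left.2 hin, hvs y]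
    intro w hw
    rw [Metric.mem_closedBall] at hy
    rw [Metric.mem_ball] at hw
    rw [hB, Metric.mem_ball]
    linarith [dist_triangle w y z]
  have h3 : ∫⁻ y, g y * volume (Metric.ball y s ∩ B) ≤
      (∫⁻ y in Metric.ball z (ρ + 2 * s), g y) * volume (Metric.ball z s) := by
    rw [← lintegral_mul_const _ hg, ← lintegral_indicator measurableSet_ball]
    refine lintegral_mono fun y => ?_
    by_cases hy : y ∈ Metric.ball z (ρ + 2 * s)
    · rw [Set.indicator_of_mem hy, ← hvs y]
      dsimp only
      gcongr
      exact Set.inter_subset_left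
    · have : Metric.ball y s ∩ B = ∅ := by
        ext w
        simp only [Set.mem_inter_iff, Metric.mem_ball, hB, Set.mem_empty_iff_false, iff_false, not_and]
        intro h1 h2
        apply hy
        rw [Metric.mem_ball]
        linarith [dist_triangle y w z, dist_comm y w]
      rw [this]; simp
  calc _ ≤ _ := h2
    _ ≤ _ := h1
    _ ≤ _ := by
      rw [mul_assoc]; gcongr



lemma scale_est {d : ℕ} {p : ℝ} (hp : 1 < p) {Ω : Set (Ed d)} {V : Ed d → ℝ}
    (hV : LocBddOn Ω V) (hQ : ∀ w, IsTestOn Ω w → 0 ≤ qV p V w) {z : Ed d} {R ρ M C0 : ℝ}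
    (hR : 0 < R) (hρ : 0 < ρ) (hρR : ρ ≤ R) (hM : 0 ≤ M) (hC0 : 0 ≤ C0)
    (hsub : Metric.closedBall z (11 * R) ⊆ Ω)
    (hVM : ∀ᵐ y ∂(volume : Measure (Ed d)), y ∈ Metric.closedBall z (11 * R) → |V y| ≤ M) :
    ∃ A Λ C : ℝ, 0 ≤ A ∧ 1 ≤ Λ ∧ 0 ≤ C ∧ ∀ (u : Ed d → ℝ) (ε : ℝ), IsTestOn Ω u → 0 < ε →
      qV p V u ≤ ε → ∫ y in Metric.ball z ρ, |u y| ^ p ≤ C0 * ε → ∀ (n : ℕ), ∀ x ∈ Metric.ball z (3 * R),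
      ∫⁻ y in Metric.ball x (4 * R / 2 ^ n), ‖u y‖ₑ ^ p ≤
        ENNReal.ofReal (C * (4 * R / 2 ^ n) ^ p) *
          (∫⁻ y in Metric.ball x (4 * R / 2 ^ n), ‖fderiv ℝ u y‖ₑ ^ p) + ENNReal.ofReal (ε * A * Λ ^ n) := by
  have hp0 : 0 < p := by linarith
  set S := 4 * R with hS
  have hS0 : 0 < S := by positivity
  have hω := om_pos d
  obtain ⟨C, hC, hosc⟩ := osc hp hV hQ hS0 hM
  set m0 : ℝ := S ^ d / ρ ^ d * (C0 / S ^ p + C) + 1 with hm0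
  have hm0p : 0 < m0 := by positivity
  set C4 : ℝ := C * 2 ^ d with hC4
  refine ⟨2 ^ p * S ^ p * Real.exp (2 * m0), Real.exp (2 * C4), 2 * 2 ^ p * (2 ^ p * 2 ^ d), by positivity,
    Real.one_le_exp (by positivity), by positivity, ?_⟩
  intro u ε hu hε hqu hρu n x hx
  have hu1 : ContDiff ℝ 1 u := hu.1.of_le (by simp)
  have hxz : dist x z < 3 * R := hx
  set s : ℕ → ℝ := fun j => S / 2 ^ j with hs
  have hs0 : ∀ j, 0 < s j := fun j => by simp only [hs]; positivity
  have hsS : ∀ j, s j ≤ S := fun j => by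
    simp only [hs]; exact div_le_self hS0.le (one_le_pow₀ (by norm_num))
  have hss : ∀ j, s j = 2 * s (j + 1) := fun j => by simp only [hs]; field_simp; ring
  have hsanti : ∀ j, j ≤ n → s n ≤ s j := fun j hj => by
    simp only [hs]
    apply div_le_div_of_nonneg_left hS0.le (by positivity)
    exact pow_le_pow_right₀ (by norm_num) hj
  set w : ℕ → ℝ := fun j => s j ^ d * om d with hw
  have hw0 : ∀ j, 0 < w j := fun j => by have := hs0 j; simp only [hw]; positivity
  have hwanti : ∀ j, j ≤ n → w n ≤ w j := fun j hj => by
    have := hsanti j hj; have := hs0 n; simp only [hw]; gcongr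
  have hvw : ∀ j, volume (Metric.ball x (s j)) = ENNReal.ofReal (w j) := fun j => vol_ball x (hs0 j)
  set t := ε * S ^ p / w n with ht
  have ht0 : 0 < t := by have := hw0 n; positivity
  have hεt : ε / t = w n / S ^ p := by
    have := hw0 n
    rw [ht]; field_simp
  set F := Fl p t u with hF
  have hFs : ContDiff ℝ 1 F := Fl_smooth hp ht0 hu1
  have hFc := hFs.continuous
  have hcb : ∀ j, Metric.closedBall x (2 * s j) ⊆ Metric.closedBall z (11 * R) := fun j => by
    apply Metric.closedBall_subset_closedBall'
    have := hsS j
    linarith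
  have hO : ∀ j, j ≤ n → ∫⁻ a in Metric.ball x (s j), ∫⁻ b in Metric.ball x (s j), ‖F a - F b‖ₑ ≤
      ENNReal.ofReal C * (volume (Metric.ball x (s j)) * volume (Metric.ball x (s j))) := by
    intro j hj
    refine hosc x (s j) u ε t (hs0 j) (hsS j) ((hcb j).trans hsub) ?_ hu hqu ht0 ?_
    · filter_upwards [hVM] with y hy h
      exact hy (hcb j h)
    · rw [hεt]
      refine le_trans ?_ (hwanti j hj)
      rw [div_mul_eq_mul_div, div_le_iff₀ (by positivity)]
      have := hw0 n
      gcongr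
      exact hsS j
  -- start
  have hB0 : ∀ j, volume (Metric.ball x (s j)) ≠ 0 := fun j => (Metric.measure_ball_pos _ _ (hs0 j)).ne'
  have hBt : ∀ j, volume (Metric.ball x (s j)) ≠ ⊤ := fun j => measure_ball_lt_top.ne
  have hFρ : ∫⁻ y in Metric.ball z ρ, ‖F y‖ₑ ≤ ENNReal.ofReal (C0 / S ^ p * w 0) := by
    calc ∫⁻ y in Metric.ball z ρ, ‖F y‖ₑ ≤ ∫⁻ y in Metric.ball z ρ, ENNReal.ofReal t⁻¹ * ‖u y‖ₑ ^ p := by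
          refine lintegral_mono fun y => ?_
          rw [← ofReal_norm, ← ofReal_norm, ENNReal.ofReal_rpow_of_nonneg (norm_nonneg _) hp0.le,
            ← ENNReal.ofReal_mul (by positivity)]
          apply ENNReal.ofReal_le_ofReal
          rw [Real.norm_of_nonneg (Fl_nonneg ht0 u y), Real.norm_eq_abs, inv_mul_eq_div]
          exact Fl_le ht0 u y
      _ = ENNReal.ofReal (t⁻¹ * ∫ y in Metric.ball z ρ, |u y| ^ p) := by
          rw [lintegral_const_mul' _ _ ENNReal.ofReal_ne_top, lint_absp hp hu.1.continuous hu.2.1,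
            ENNReal.ofReal_mul (by positivity)]
      _ ≤ _ := by
          apply ENNReal.ofReal_le_ofReal
          calc _ ≤ t⁻¹ * (C0 * ε) := by gcongr
            _ = C0 * (ε / t) := by ring
            _ = C0 / S ^ p * w n := by rw [hεt]; ring
            _ ≤ _ := by
              have := hwanti 0 (Nat.zero_le n)
              gcongr
  have hρs : Metric.ball z ρ ⊆ Metric.ball x (s 0) := by
    apply Metric.ball_subset_ball'
    simp only [hs, pow_zero, div_one]
    rw [dist_comm]; linarith
  have hstart : ∫⁻ y in Metric.ball x (s 0), ‖F y‖ₑ ≤ ENNReal.ofReal m0 * volume (Metric.ball x (s 0)) := by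
    have h1 := mean_step hFc (Metric.ball x (s 0)) (Metric.ball z ρ)
    have h2 : ∫⁻ a in Metric.ball x (s 0), ∫⁻ b in Metric.ball z ρ, ‖F a - F b‖ₑ ≤
        ENNReal.ofReal C * (volume (Metric.ball x (s 0)) * volume (Metric.ball x (s 0))) :=
      (lintegral_mono fun a => lintegral_mono_set hρs).trans (hO 0 (Nat.zero_le n))
    have hz0 : volume (Metric.ball z ρ) ≠ 0 := (Metric.measure_ball_pos _ _ hρ).ne'
    have hzt : volume (Metric.ball z ρ) ≠ ⊤ := measure_ball_lt_top.ne
    rw [← ENNReal.mul_le_mul_iff_left hz0 hzt]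
    refine h1.trans ((add_le_add (mul_le_mul_right hFρ _) h2).trans ?_)
    have h0 := hw0 0
    rw [hvw 0, vol_ball z hρ, ← ENNReal.ofReal_mul h0.le, ← ENNReal.ofReal_mul h0.le,
      ← ENNReal.ofReal_mul hC, ← ENNReal.ofReal_add (by positivity) (by positivity),
      ← ENNReal.ofReal_mul hm0p.le, ← ENNReal.ofReal_mul (by positivity)]
    apply ENNReal.ofReal_le_ofReal
    have e0 : w 0 = S ^ d * om d := by simp [hw, hs]
    have e1 : m0 * w 0 * (ρ ^ d * om d) = w 0 * (C0 / S ^ p * w 0) + C * (w 0 * w 0) + w 0 * (ρ ^ d * om d) := by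
      rw [hm0, e0]; field_simp
    rw [e1]
    have : 0 ≤ w 0 * (ρ ^ d * om d) := by positivity
    linarith
  have hmean : ∀ j, j ≤ n → ∫⁻ y in Metric.ball x (s j), ‖F y‖ₑ ≤
      ENNReal.ofReal (m0 + j * C4) * volume (Metric.ball x (s j)) := by
    intro j
    induction j with
    | zero => intro _; simpa using hstart
    | succ j ih =>
      intro hj
      have h1 := ih (by omega)
      have h2 := mean_down hFc (B' := Metric.ball x (s (j + 1)))
        (Metric.ball_subset_ball (by rw [hss j]; linarith [hs0 (j+1)])) (hB0 j) (hBt j) h1 (hO j (by omega))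
      refine h2.trans (le_of_eq ?_)
      have e1 : w j = 2 ^ d * w (j + 1) := by
        simp only [hw]; rw [hss j, mul_pow]; ring
      have := hw0 (j+1)
      rw [hvw, hvw, e1, ← ENNReal.ofReal_mul (by positivity), ← ENNReal.ofReal_mul hC,
        ← ENNReal.ofReal_add (by positivity) (by positivity), ← ENNReal.ofReal_mul (by positivity)]
      congr 1; push_cast; rw [hC4]; ring
  set a : ℝ := m0 + n * C4 with ha
  have ha0 : 0 < a := by positivity
  have hmn := hmean n le_rfl
  set B := Metric.ball x (s n) with hB
  set G := {y | F y < 2 * a} ∩ B with hG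
  have hGm : MeasurableSet G := (isOpen_lt hFc continuous_const).measurableSet.inter measurableSet_ball
  have hbad : 2 * volume (B \ {y | F y < 2 * a}) ≤ volume B := by
    have h1 : ENNReal.ofReal (2 * a) * volume (B \ {y | F y < 2 * a}) ≤ ∫⁻ y in B, ‖F y‖ₑ := by
      have hbm : MeasurableSet (B \ {y | F y < 2 * a}) :=
        measurableSet_ball.diff (isOpen_lt hFc continuous_const).measurableSet
      calc _ = ∫⁻ y in B \ {y | F y < 2 * a}, ENNReal.ofReal (2 * a) := by rw [setLIntegral_const]
        _ ≤ ∫⁻ y in B \ {y | F y < 2 * a}, ‖F y‖ₑ := by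
            refine setLIntegral_mono' hbm fun y hy => ?_
            rw [← ofReal_norm]
            apply ENNReal.ofReal_le_ofReal
            rw [Real.norm_of_nonneg (Fl_nonneg ht0 u y)]
            exact not_lt.1 hy.2
        _ ≤ _ := lintegral_mono_set Set.sdiff_subset
    have h2 := h1.trans hmn
    rw [show ENNReal.ofReal (2 * a) = ENNReal.ofReal a * ENNReal.ofReal 2 by
      rw [← ENNReal.ofReal_mul ha0.le, mul_comm], mul_assoc] at h2
    rw [ENNReal.mul_le_mul_iff_right (by simpa using ha0) ENNReal.ofReal_ne_top] at h2
    simpa using h2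
  have hGB : volume B ≤ 2 * volume G := by
    have h1 : volume B ≤ volume G + volume (B \ {y | F y < 2 * a}) := by
      refine le_trans (measure_mono ?_) (measure_union_le _ _)
      intro y hy
      by_cases h : F y < 2 * a
      · exact Or.inl ⟨h, hy⟩
      · exact Or.inr ⟨hy, h⟩
    have h2 : volume B + volume B ≤ 2 * volume G + volume B := by
      calc volume B + volume B ≤ 2 * volume B := by rw [two_mul]
        _ ≤ 2 * (volume G + volume (B \ {y | F y < 2 * a})) := by gcongr
        _ = 2 * volume G + 2 * volume (B \ {y | F y < 2 * a}) := by ring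
        _ ≤ _ := by gcongr
    exact (ENNReal.add_le_add_iff_right (hBt n)).1 h2
  have hkG : ∀ y ∈ G, ‖u y‖ₑ ^ p ≤ ENNReal.ofReal (t * Real.exp (2 * a)) := by
    intro y hy
    rw [← ofReal_norm, ENNReal.ofReal_rpow_of_nonneg (norm_nonneg _) hp0.le, Real.norm_eq_abs]
    apply ENNReal.ofReal_le_ofReal
    have h1 : Fl p t u y < 2 * a := hy.1
    unfold Fl at h1
    have h0 : 0 ≤ |u y| ^ p / t := by positivity
    rw [Real.log_lt_iff_lt_exp (by linarith)] at h1
    have : |u y| ^ p / t ≤ Real.exp (2 * a) := by linarith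
    rw [div_le_iff₀ ht0] at this
    linarith
  have hfin := half_lem hp hu1 x (hs0 n) (G := G) Set.inter_subset_right hGm hGB hkG
  refine hfin.trans (le_of_eq ?_)
  have e2 : (2 : ENNReal) ^ p = ENNReal.ofReal (2 ^ p) := by
    rw [← ENNReal.ofReal_rpow_of_nonneg (by norm_num) hp0.le]; simp
  have e2' : (2 : ENNReal) = ENNReal.ofReal 2 := by simp
  congr 1
  · congr 1
    rw [e2, e2', ← ENNReal.ofReal_mul (by positivity), ← ENNReal.ofReal_mul (by positivity),
      Real.mul_rpow (by norm_num) (hs0 n).le]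
    congr 1; ring
  · rw [hvw, e2, ← ENNReal.ofReal_mul (by positivity), ← ENNReal.ofReal_mul (by positivity)]
    congr 1
    have := hw0 n
    rw [ht, ha, ← Real.exp_nat_mul, mul_add, Real.exp_add]
    rw [show 2 * (n * C4) = n * (2 * C4) by ring]
    field_simp



lemma iter_lem {Φ : ℕ → ℝ} {Λ E T : ℝ} (hΛ : 1 ≤ Λ) (h0 : ∀ i, 0 ≤ Φ i)
    (hT : ∀ i, Φ i ≤ T) (h : ∀ i, Φ i ≤ (2 * Λ)⁻¹ * Φ (i + 1) + E * Λ ^ i) : Φ 0 ≤ 2 * E := by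
  have hΛ0 : 0 < Λ := by linarith
  have key : ∀ n : ℕ, Φ 0 ≤ 2 * E * (1 - (1 / 2) ^ n) + ((2 * Λ)⁻¹) ^ n * Φ n := by
    intro n
    induction n with
    | zero => simp
    | succ n ih =>
      have h1 := mul_le_mul_of_nonneg_left (h n) (by positivity : 0 ≤ ((2 * Λ)⁻¹) ^ n)
      have e1 : ((2 * Λ)⁻¹) ^ n * ((2 * Λ)⁻¹ * Φ (n + 1) + E * Λ ^ n) =
          ((2 * Λ)⁻¹) ^ (n + 1) * Φ (n + 1) + E * (1 / 2) ^ n := by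
        rw [mul_add, pow_succ, mul_assoc]
        congr 1
        rw [mul_inv, mul_pow, inv_pow Λ]
        field_simp
      rw [e1] at h1
      have e2 : (1 / 2 : ℝ) ^ (n + 1) = (1 / 2) ^ n / 2 := by rw [pow_succ]; ring
      rw [e2]
      linarith
  have key2 : ∀ n : ℕ, Φ 0 ≤ 2 * E * (1 - (1 / 2) ^ n) + (1 / 2) ^ n * T := by
    intro n
    refine (key n).trans ?_
    have h1 : ((2 * Λ)⁻¹) ^ n ≤ (1 / 2) ^ n := by
      apply pow_le_pow_left₀ (by positivity)
      rw [one_div]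
      exact inv_anti₀ (by norm_num) (by linarith)
    have := mul_le_mul h1 (hT n) (h0 n) (by positivity)
    linarith
  have hl : Tendsto (fun n : ℕ => (1 / 2 : ℝ) ^ n) atTop (𝓝 0) :=
    tendsto_pow_atTop_nhds_zero_of_lt_one (by norm_num) (by norm_num)
  have hl2 : Tendsto (fun n : ℕ => 2 * E * (1 - (1 / 2 : ℝ) ^ n) + (1 / 2) ^ n * T) atTop
      (𝓝 (2 * E * (1 - 0) + 0 * T)) :=
    ((hl.const_sub 1).const_mul (2 * E)).add (hl.mul_const T)
  have := ge_of_tendsto hl2 (Eventually.of_forall key2)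
  simpa using this

lemma local_step {d : ℕ} {p : ℝ} (hp : 1 < p) {Ω : Set (Ed d)} {V : Ed d → ℝ}
    (hV : LocBddOn Ω V) (hQ : ∀ w, IsTestOn Ω w → 0 ≤ qV p V w) {z : Ed d} {R ρ C0 : ℝ}
    (hR : 0 < R) (hρ : 0 < ρ) (hρR : ρ ≤ R) (hC0 : 0 ≤ C0)
    (hsub : Metric.closedBall z (11 * R) ⊆ Ω) :
    ∃ C' : ℝ, 0 ≤ C' ∧ ∀ (u : Ed d → ℝ) (ε : ℝ), IsTestOn Ω u → 0 < ε →
      qV p V u ≤ ε → ∫ y in Metric.ball z ρ, |u y| ^ p ≤ C0 * ε →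
      ∫ y in Metric.ball z R, |u y| ^ p ≤ C' * ε := by
  have hp0 : 0 < p := by linarith
  have hω := om_pos d
  obtain ⟨M', hM'⟩ := hV.2 _ (isCompact_closedBall z (11 * R)) hsub
  set M := max M' 0 with hMd
  have hM : 0 ≤ M := le_max_right _ _
  have hVM : ∀ᵐ y ∂(volume : Measure (Ed d)), y ∈ Metric.closedBall z (11 * R) → |V y| ≤ M := by
    filter_upwards [hM'] with y hy h
    exact (hy h).trans (le_max_left _ _)
  obtain ⟨A, Λ, C, hA, hΛ, hC, hscale⟩ := scale_est hp hV hQ hR hρ hρR hM hC0 hsub hVM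
  obtain ⟨Lb, hLb, hbump⟩ := exists_bump d
  obtain ⟨m, hm⟩ := exists_nat_ge p
  set Λ' := Λ * 2 ^ d with hΛ'
  have hΛ1 : 1 ≤ Λ' := one_le_mul_of_one_le_of_one_le hΛ (one_le_pow₀ (by norm_num))
  set D := C * ((16 * m * Lb) ^ p + (4 * R) ^ p * M) with hD
  have hD0 : 0 ≤ D := by positivity
  obtain ⟨a0, ha0⟩ := pow_unbounded_of_one_lt (2 * Λ' * D) (by norm_num : (1:ℝ) < 2)
  set a := a0 + 5 with ha
  have ha32 : (32:ℝ) ≤ 2 ^ a := by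
    rw [ha, pow_add]
    have : (1:ℝ) ≤ 2 ^ a0 := one_le_pow₀ (by norm_num)
    linarith
  have haD : D / 2 ^ a ≤ (2 * Λ')⁻¹ := by
    rw [div_le_iff₀ (by positivity), inv_mul_eq_div, le_div_iff₀ (by positivity)]
    have : (2:ℝ) ^ a0 ≤ 2 ^ a := pow_le_pow_right₀ (by norm_num) (by omega)
    linarith
  set E := C * (4 * R) ^ p + A * Λ' ^ a with hE
  refine ⟨2 * E, by positivity, ?_⟩
  intro u ε hu hε hqu hρu
  have hint := int_absp hp hu.1.continuous hu.2.1
  set Rs : ℕ → ℝ := fun i => 2 * R - R / 2 ^ i with hRs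
  set Φ : ℕ → ℝ := fun i => ∫ y in Metric.closedBall z (Rs i), |u y| ^ p with hΦ
  have hΦ0 : ∀ i, 0 ≤ Φ i := fun i => integral_nonneg fun y => by positivity
  have hΦT : ∀ i, Φ i ≤ ∫ y, |u y| ^ p := fun i =>
    setIntegral_le_integral hint (Eventually.of_forall fun y => by positivity)
  have hmain : ∀ i, Φ i ≤ (2 * Λ')⁻¹ * Φ (i + 1) + (E * ε) * Λ' ^ i := by
    intro i
    set n := a + i with hn
    set s := 4 * R / 2 ^ n with hs
    have hs0 : 0 < s := by positivity
    have h2i : (1:ℝ) ≤ 2 ^ i := one_le_pow₀ (by norm_num)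
    set q := R / 2 ^ i with hq
    have hq0 : 0 < q := by positivity
    have hqR : q ≤ R := div_le_self hR.le h2i
    have hsq : s = 4 * q / 2 ^ a := by
      rw [hs, hq, hn, pow_add]; field_simp
    have hs8 : 8 * s ≤ q := by
      rw [hsq, ← mul_div_assoc, div_le_iff₀ (by positivity)]
      nlinarith
    have hRi : Rs i = 2 * R - q := rfl
    have hRi1 : Rs (i + 1) = 2 * R - q / 2 := by
      simp only [hRs, hq, pow_succ]; field_simp
    -- cacc
    obtain ⟨b, hbs, hb0, hb1, hbr, hbR, hbL⟩ := hbump z (Rs i + 2 * s) (Rs (i + 1))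
      (by rw [hRi]; linarith) (by rw [hRi, hRi1]; linarith)
    have hgap : q / 4 ≤ Rs (i + 1) - (Rs i + 2 * s) := by rw [hRi, hRi1]; linarith
    have hcb : Metric.closedBall z (Rs (i + 1)) ⊆ Metric.closedBall z (11 * R) :=
      Metric.closedBall_subset_closedBall (by rw [hRi1]; linarith)
    have hca := cacc hp hm hV hQ hu hbs hb0 hb1 (x := z) (r := Rs i + 2 * s) (R := Rs (i + 1)) (M := M)
      (L := 4 * Lb / q)
      (fun y hy => hbr y (Metric.ball_subset_closedBall hy))
      (fun y hy => hbR y (fun h => hy (Metric.ball_subset_closedBall h)))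
      (fun y => (hbL y).trans (by
        rw [div_le_div_iff₀ (by linarith) hq0]
        nlinarith))
      (by filter_upwards [hVM] with y hy h; exact hy (hcb h))
    set I := ∫ y in Metric.ball z (Rs i + 2 * s), ‖fderiv ℝ u y‖ ^ p with hI
    have hΦ1 : Φ (i + 1) = ∫ y in Metric.closedBall z (Rs (i + 1)), |u y| ^ p := rfl
    rw [← hΦ1] at hca
    have hI0 : 0 ≤ I := integral_nonneg fun y => by positivity
    -- averaging
    have hav := averaging (f := fun y => ‖u y‖ₑ ^ p) (g := fun y => ‖fderiv ℝ u y‖ₑ ^ p)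
      (hu.1.continuous.enorm.measurable.pow_const p)
      ((hu.1.continuous_fderiv (by simp)).enorm.measurable.pow_const p) (z := z) (ρ := Rs i) hs0
      (fun x hx => hscale u ε hu hε hqu hρu n x
        (Metric.ball_subset_ball (by rw [hRi]; linarith) hx))
    have hvol : volume (Metric.ball z (Rs i + s)) ≤ ENNReal.ofReal ((4 * R) ^ d * om d) := by
      rw [← vol_ball z (by positivity)]
      exact measure_mono (Metric.ball_subset_ball (by rw [hRi]; linarith))
    have hav2 := hav.trans (add_le_add le_rfl (mul_le_mul_right hvol _))
    rw [lint_absp hp hu.1.continuous hu.2.1, lint_gradp hp hu.1 hu.2.1, vol_ball z hs0, ← hI,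
      ← ENNReal.ofReal_mul (hΦ0 i), ← ENNReal.ofReal_mul (by positivity), ← ENNReal.ofReal_mul (by positivity),
      ← ENNReal.ofReal_mul (by positivity), ← ENNReal.ofReal_add (by positivity) (by positivity),
      ENNReal.ofReal_le_ofReal_iff (by positivity)] at hav2
    have e4 : (4 * R) ^ d = (2 ^ d) ^ n * s ^ d := by
      rw [hs, div_pow, ← pow_mul, ← pow_mul, mul_comm d n]; field_simp
    have hav3 : Φ i ≤ C * s ^ p * I + ε * A * Λ' ^ n := by
      have hpos : 0 < s ^ d * om d := by positivity
      refine le_of_mul_le_mul_right ?_ hpos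
      refine hav2.trans (le_of_eq ?_)
      rw [e4, hΛ', mul_pow]; ring
    -- combine
    have hsp : s ^ p ≤ (4 * R) ^ p := by
      apply Real.rpow_le_rpow hs0.le _ hp0.le
      linarith
    have h2a : (2:ℝ) ^ a ≤ ((2:ℝ) ^ a) ^ p := by
      have := Real.rpow_le_rpow_of_exponent_le (by linarith : (1:ℝ) ≤ 2 ^ a) hp.le
      rwa [Real.rpow_one] at this
    have hco : C * s ^ p * ((m * (4 * Lb / q)) ^ p + M) ≤ D / 2 ^ a := by
      have e5 : s ^ p * (m * (4 * Lb / q)) ^ p ≤ (16 * m * Lb) ^ p / 2 ^ a := by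
        rw [← Real.mul_rpow hs0.le (by positivity),
          show s * (m * (4 * Lb / q)) = (16 * m * Lb) / 2 ^ a by rw [hsq]; field_simp; ring,
          Real.div_rpow (by positivity) (by positivity)]
        apply div_le_div_of_nonneg_left (by positivity) (by positivity) h2a
      have e6 : s ^ p ≤ (4 * R) ^ p / 2 ^ a := by
        calc s ^ p ≤ (4 * R / 2 ^ a) ^ p := by
              apply Real.rpow_le_rpow hs0.le _ hp0.le
              rw [hsq]; gcongr
          _ = (4 * R) ^ p / (2 ^ a) ^ p := Real.div_rpow (by positivity) (by positivity) _
          _ ≤ _ := div_le_div_of_nonneg_left (by positivity) (by positivity) h2a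
      calc C * s ^ p * ((m * (4 * Lb / q)) ^ p + M) = C * (s ^ p * (m * (4 * Lb / q)) ^ p + s ^ p * M) := by ring
        _ ≤ C * ((16 * m * Lb) ^ p / 2 ^ a + (4 * R) ^ p / 2 ^ a * M) := by gcongr
        _ = D / 2 ^ a := by rw [hD]; ring
    have hCs : 0 ≤ C * s ^ p := by positivity
    have hΛi : 1 ≤ Λ' ^ i := one_le_pow₀ hΛ1
    calc Φ i ≤ C * s ^ p * I + ε * A * Λ' ^ n := hav3
      _ ≤ C * s ^ p * (ε + ((m * (4 * Lb / q)) ^ p + M) * Φ (i + 1)) + ε * A * Λ' ^ n := by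
          gcongr; linarith
      _ = (C * s ^ p * ((m * (4 * Lb / q)) ^ p + M)) * Φ (i + 1) + (C * s ^ p * ε * 1 + ε * A * Λ' ^ n) := by ring
      _ ≤ (2 * Λ')⁻¹ * Φ (i + 1) + (C * (4 * R) ^ p * ε * Λ' ^ i + ε * A * Λ' ^ n) := by
          have := hΦ0 (i + 1)
          gcongr
          exact hco.trans haD
      _ = _ := by rw [hE, hn, pow_add]; ring
  have hfin := iter_lem hΛ1 hΦ0 hΦT hmain
  have hR0 : Rs 0 = R := by simp [hRs]; ring
  calc ∫ y in Metric.ball z R, |u y| ^ p ≤ Φ 0 := by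
        simp only [hΦ, hR0]
        exact setIntegral_mono_set hint.integrableOn (Eventually.of_forall fun y => by positivity)
          (Metric.ball_subset_closedBall.eventuallyLE)
    _ ≤ _ := by linarith



def LC {d : ℕ} (p : ℝ) (Ω : Set (Ed d)) (V : Ed d → ℝ) (z : Ed d) (ρ C : ℝ) : Prop :=
  0 ≤ C ∧ ∀ (u : Ed d → ℝ) (ε : ℝ), IsTestOn Ω u → 0 < ε → qV p V u ≤ ε →
    ∫ y in Metric.ball z ρ, |u y| ^ p ≤ C * ε

lemma LC_mono {d : ℕ} {p : ℝ} (hp : 1 < p) {Ω : Set (Ed d)} {V : Ed d → ℝ} {z z' : Ed d} {ρ ρ' C : ℝ}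
    (h : LC p Ω V z ρ C) (hs : Metric.ball z' ρ' ⊆ Metric.ball z ρ) : LC p Ω V z' ρ' C := by
  refine ⟨h.1, fun u ε hu hε hq => le_trans ?_ (h.2 u ε hu hε hq)⟩
  exact setIntegral_mono_set (int_absp hp hu.1.continuous hu.2.1).integrableOn
    (Eventually.of_forall fun y => by positivity) hs.eventuallyLE

lemma test_mono {d : ℕ} {Ω₁ Ω₂ : Set (Ed d)} (h : Ω₁ ⊆ Ω₂) {u : Ed d → ℝ} (hu : IsTestOn Ω₁ u) :
    IsTestOn Ω₂ u := ⟨hu.1, hu.2.1, hu.2.2.trans h⟩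

lemma LC_all {d : ℕ} {p : ℝ} (hp : 1 < p) {Ω₁ Ω₂ : Set (Ed d)}
    (hopen₂ : IsOpen Ω₂) (hconn₂ : IsConnected Ω₂)
    (hsub : Ω₁ ⊆ Ω₂) (hstrict : (Ω₂ \ closure Ω₁).Nonempty)
    {V : Ed d → ℝ} (hV : LocBddOn Ω₂ V) (hQ : ∀ w, IsTestOn Ω₂ w → 0 ≤ qV p V w) :
    ∀ z ∈ Ω₂, ∃ ρ C, 0 < ρ ∧ LC p Ω₁ V z ρ C := by
  have hp0 : 0 < p := by linarith
  set G : Set (Ed d) := {z | ∃ ρ C, 0 < ρ ∧ LC p Ω₁ V z ρ C} with hG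
  have hGo : IsOpen G := by
    rw [Metric.isOpen_iff]
    rintro z ⟨ρ, C, hρ, h⟩
    refine ⟨ρ, hρ, fun z' hz' => ?_⟩
    rw [Metric.mem_ball] at hz'
    exact ⟨ρ - dist z' z, C, by linarith, LC_mono hp h (Metric.ball_subset_ball' (by linarith))⟩
  have hne : (Ω₂ ∩ G).Nonempty := by
    obtain ⟨z, hz, hz'⟩ := hstrict
    obtain ⟨ρ, hρ, hb⟩ := Metric.isOpen_iff.1 isClosed_closure.isOpen_compl z hz'
    refine ⟨z, hz, ρ, 0, hρ, le_rfl, fun u ε hu hε hq => ?_⟩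
    rw [zero_mul]
    apply le_of_eq
    rw [setIntegral_congr_fun (g := fun _ => (0:ℝ)) measurableSet_ball]
    · simp
    · intro y hy
      have : y ∉ tsupport u := fun h => hb hy (subset_closure (hu.2.2 h))
      simp only
      rw [image_eq_zero_of_notMem_tsupport this]
      simp [Real.zero_rpow hp0.ne']
  have hcl : closure G ∩ Ω₂ ⊆ G := by
    rintro z ⟨hzc, hz⟩
    obtain ⟨δ, hδ, hb⟩ := Metric.isOpen_iff.1 hopen₂ z hz
    set r := δ / 13 with hr
    have hr0 : 0 < r := by positivity
    obtain ⟨z', ⟨ρ', C, hρ', h⟩, hd⟩ := Metric.mem_closure_iff.1 hzc r hr0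
    have hsub' : Metric.closedBall z' (11 * r) ⊆ Ω₂ := by
      refine subset_trans ?_ hb
      intro y hy
      rw [Metric.mem_closedBall] at hy
      rw [Metric.mem_ball]
      have := dist_triangle y z' z
      rw [dist_comm z' z] at this
      have : δ = 13 * r := by rw [hr]; ring
      linarith
    have h' := LC_mono hp h (Metric.ball_subset_ball (min_le_left ρ' r))
    obtain ⟨C', hC', hst⟩ := local_step hp hV hQ hr0 (lt_min hρ' hr0) (min_le_right ρ' r) h.1 hsub'
    have hLC : LC p Ω₁ V z' r C' :=
      ⟨hC', fun u ε hu hε hq => hst u ε (test_mono hsub hu) hε hq (h'.2 u ε hu hε hq)⟩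
    exact ⟨r - dist z z', C', by linarith, LC_mono hp hLC (Metric.ball_subset_ball' (by linarith))⟩
  exact hconn₂.isPreconnected.subset_of_closure_inter_subset hGo hne hcl

lemma part1 {d : ℕ} {p : ℝ} (hp : 1 < p) {Ω₁ Ω₂ : Set (Ed d)} (hconn₁ : IsConnected Ω₁)
    (hopen₂ : IsOpen Ω₂) (hconn₂ : IsConnected Ω₂)
    (hsub : Ω₁ ⊆ Ω₂) (hstrict : (Ω₂ \ closure Ω₁).Nonempty)
    {V : Ed d → ℝ} (hV : LocBddOn Ω₂ V) (hN : NonnegOn p Ω₂ V) : SubcriticalOn p Ω₁ V := by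
  have hp0 : 0 < p := by linarith
  have hQ : ∀ w, IsTestOn Ω₂ w → 0 ≤ qV p V w := fun w hw => by
    rw [← Qp_eq hp hw]; exact hN w hw
  have hall := LC_all hp hopen₂ hconn₂ hsub hstrict hV hQ
  have hall1 : ∀ z, ∃ ρ C, z ∈ Ω₁ → 0 < ρ ∧ LC p Ω₁ V z ρ C := by
    intro z
    by_cases hz : z ∈ Ω₁
    · obtain ⟨ρ, C, h⟩ := hall z (hsub hz)
      exact ⟨ρ, C, fun _ => h⟩
    · exact ⟨0, 0, fun h => absurd h hz⟩
  choose ρ C hρC using hall1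
  obtain ⟨T, hTs, hTc, hTcov⟩ := TopologicalSpace.countable_cover_nhdsWithin
    (f := fun z => Metric.ball z (ρ z)) (s := Ω₁)
    (fun z hz => mem_nhdsWithin_of_mem_nhds (Metric.ball_mem_nhds z (hρC z hz).1))
  have hTne : T.Nonempty := by
    obtain ⟨z, hz⟩ := hconn₁.nonempty
    have := hTcov hz
    simp only [Set.mem_iUnion] at this
    obtain ⟨i, hi, _⟩ := this
    exact ⟨i, hi⟩
  obtain ⟨ζ, hζ⟩ := hTc.exists_eq_range hTne
  have hζ1 : ∀ j, ζ j ∈ Ω₁ := fun j => hTs (by rw [hζ]; exact ⟨j, rfl⟩)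
  set χ : ℕ → Ed d → ℝ := fun j x => min 1 (max 0 (ρ (ζ j) - dist x (ζ j))) with hχ
  have hχ0 : ∀ j x, 0 ≤ χ j x := fun j x => le_min zero_le_one (le_max_left _ _)
  have hχ1 : ∀ j x, χ j x ≤ 1 := fun j x => min_le_left _ _
  have hχc : ∀ j, Continuous (χ j) := fun j => by simp only [hχ]; fun_prop
  have hχz : ∀ j x, x ∉ Metric.ball (ζ j) (ρ (ζ j)) → χ j x = 0 := fun j x hx => by
    rw [Metric.mem_ball, not_lt] at hx
    simp only [hχ]
    rw [max_eq_left (by linarith)]; simp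
  have hχp : ∀ j x, x ∈ Metric.ball (ζ j) (ρ (ζ j)) → 0 < χ j x := fun j x hx => by
    rw [Metric.mem_ball] at hx
    exact lt_min one_pos (lt_max_of_lt_right (by linarith))
  have hCn : ∀ j, 0 ≤ C (ζ j) := fun j => (hρC _ (hζ1 j)).2.1
  set k : ℕ → ℝ := fun j => 1 / 2 / 2 ^ j * (1 + C (ζ j))⁻¹ with hk
  have hk0 : ∀ j, 0 < k j := fun j => by have := hCn j; simp only [hk]; positivity
  have hinv : ∀ j, (1 + C (ζ j))⁻¹ ≤ 1 := fun j => inv_le_one_of_one_le₀ (by have := hCn j; linarith)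
  have hk1 : ∀ j, k j ≤ 1 / 2 / 2 ^ j := fun j =>
    mul_le_of_le_one_right (by positivity) (hinv j)
  have hgs : Summable (fun j : ℕ => (1:ℝ) / 2 / 2 ^ j) := (hasSum_geometric_two' 1).summable
  have hFb : ∀ j x, ‖k j * χ j x‖ ≤ 1 / 2 / 2 ^ j := fun j x => by
    have h1 := hχ0 j x; have h2 := hk0 j
    rw [Real.norm_of_nonneg (by positivity)]
    exact (mul_le_of_le_one_right h2.le (hχ1 j x)).trans (hk1 j)
  have hsum : ∀ x, Summable (fun j => k j * χ j x) := fun x =>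
    Summable.of_norm_bounded hgs (fun j => hFb j x)
  refine ⟨fun x => ∑' j, k j * χ j x, ?_, ?_, ?_⟩
  · exact (continuous_tsum (fun j => (hχc j).const_mul (k j)) hgs hFb).continuousOn
  · intro x hx
    have := hTcov hx
    simp only [Set.mem_iUnion] at this
    obtain ⟨z, hz, hxz⟩ := this
    rw [hζ] at hz
    obtain ⟨j, rfl⟩ := hz
    exact (hsum x).tsum_pos (fun i => mul_nonneg (hk0 i).le (hχ0 i x)) j (mul_pos (hk0 j) (hχp j x hxz))
  · intro u hu
    rw [Qp_eq hp hu]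
    have hu2 := test_mono hsub hu
    have hint := int_absp hp hu.1.continuous hu.2.1
    refine le_of_forall_pos_le_add fun δ hδ => ?_
    have hq0 := hQ u hu2
    set ε := qV p V u + δ with hε
    have hε0 : 0 < ε := by linarith
    set F : ℕ → Ed d → ℝ := fun j x => k j * χ j x * |u x| ^ p with hF
    have hF0 : ∀ j x, 0 ≤ F j x := fun j x => by
      have h1 := hχ0 j x; have h2 := hk0 j; simp only [hF]; positivity
    have hFi' : ∀ j, Integrable (F j) := fun j => by
      refine hint.mono' ?_ (Eventually.of_forall fun x => ?_)
      · exact (((hχc j).const_mul (k j)).mul (absp_cont hp hu.1.continuous)).aestronglyMeasurable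
      · rw [Real.norm_of_nonneg (hF0 j x)]
        apply mul_le_of_le_one_left (by positivity)
        refine (le_abs_self _).trans ((hFb j x).trans ?_)
        rw [div_div]
        apply div_le_one_of_le₀ _ (by positivity)
        have : (1:ℝ) ≤ 2 ^ j := one_le_pow₀ (by norm_num)
        linarith
    have hFb2 : ∀ j, ∫ x in Ω₁, F j x ≤ ε / 2 / 2 ^ j := fun j => by
      have hball := (hρC _ (hζ1 j)).2.2 u ε hu hε0 (by linarith)
      have hCj := hCn j
      calc ∫ x in Ω₁, F j x ≤ ∫ x, F j x :=
            setIntegral_le_integral (hFi' j) (Eventually.of_forall (hF0 j))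
        _ ≤ ∫ x, k j * (Metric.ball (ζ j) (ρ (ζ j))).indicator (fun y => |u y| ^ p) x := by
            refine integral_mono (hFi' j) ((hint.indicator measurableSet_ball).const_mul _) fun x => ?_
            simp only [hF]
            rw [mul_assoc]
            apply mul_le_mul_of_nonneg_left _ (hk0 j).le
            by_cases hx : x ∈ Metric.ball (ζ j) (ρ (ζ j))
            · rw [Set.indicator_of_mem hx]
              exact mul_le_of_le_one_left (by positivity) (hχ1 j x)
            · rw [Set.indicator_of_notMem hx, hχz j x hx, zero_mul]
        _ = k j * ∫ x in Metric.ball (ζ j) (ρ (ζ j)), |u x| ^ p := by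
            rw [integral_const_mul, integral_indicator measurableSet_ball]
        _ ≤ k j * (C (ζ j) * ε) := mul_le_mul_of_nonneg_left hball (hk0 j).le
        _ = 1 / 2 / 2 ^ j * ε * ((1 + C (ζ j))⁻¹ * C (ζ j)) := by simp only [hk]; ring
        _ ≤ 1 / 2 / 2 ^ j * ε * 1 := by
            gcongr
            rw [inv_mul_eq_div]
            apply div_le_one_of_le₀ <;> linarith
        _ = _ := by ring
    have hgε : HasSum (fun j : ℕ => ε / 2 / 2 ^ j) ε := hasSum_geometric_two' ε
    have hIsum : Summable (fun j => ∫ x in Ω₁, F j x) :=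
      Summable.of_nonneg_of_le (fun j => integral_nonneg (hF0 j)) hFb2 hgε.summable
    have e1 : ∑' j, ∫ x in Ω₁, F j x = ∫ x in Ω₁, ∑' j, F j x := by
      apply integral_tsum_of_summable_integral_norm (fun j => (hFi' j).integrableOn)
      refine hIsum.congr fun j => ?_
      refine integral_congr_ae (Eventually.of_forall fun x => ?_)
      exact (Real.norm_of_nonneg (hF0 j x)).symm
    have e2 : ∫ x in Ω₁, (∑' j, k j * χ j x) * |u x| ^ p = ∫ x in Ω₁, ∑' j, F j x := by
      congr 1; ext x; rw [← tsum_mul_right]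
    rw [e2, ← e1]
    exact (hIsum.tsum_le_tsum hFb2 hgε.summable).trans hgε.tsum_eq.le

lemma part2 {d : ℕ} {p : ℝ} (hp : 1 < p) {Ω : Set (Ed d)} {V : Ed d → ℝ}
    (hc : CriticalOn p Ω V) (hs : SubcriticalOn p Ω V) (hΩ : IsOpen Ω) : False := by
  obtain ⟨-, φ, -, -, un, ⟨ht, -, ⟨B, hBo, hBc, hBs, hB1⟩, hlim⟩, -⟩ := hc
  obtain ⟨W, hWc, hW0, hW⟩ := hs
  have hp0 : 0 < p := by linarith
  have hne : (closure B).Nonempty := by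
    rw [closure_nonempty_iff]
    by_contra h
    rw [Set.not_nonempty_iff_eq_empty] at h
    have := hB1 0
    rw [h] at this
    simp at this
  obtain ⟨x0, hx0, hmin⟩ := hBc.exists_isMinOn hne (hWc.mono hBs)
  set c := W x0 with hcd
  have hc0 : 0 < c := hW0 x0 (hBs hx0)
  have key : ∀ n, c ≤ Qp p Ω V (un n) := by
    intro n
    refine le_trans ?_ (hW _ (ht n))
    have hint := int_absp hp (ht n).1.continuous (ht n).2.1
    set K := tsupport (un n) with hK
    have hKc : IsCompact K := (ht n).2.1
    have hWi : Integrable (fun x => W x * |un n x| ^ p) (volume.restrict Ω) := by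
      have h1 : ContinuousOn (fun x => W x * |un n x| ^ p) K :=
        (hWc.mono (ht n).2.2).mul (absp_cont hp (ht n).1.continuous).continuousOn
      have h2 : IntegrableOn (fun x => W x * |un n x| ^ p) K := h1.integrableOn_compact hKc
      have h3 : Integrable (fun x => W x * |un n x| ^ p) := by
        rw [← integrableOn_iff_integrable_of_support_subset (s := K)]
        · exact h2
        · intro x hx
          by_contra h
          apply hx
          simp only
          rw [image_eq_zero_of_notMem_tsupport h]
          simp [Real.zero_rpow hp0.ne']
      exact h3.integrableOn
    calc c = ∫ x in B, c * |un n x| ^ p := by rw [integral_const_mul, hB1 n, mul_one]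
      _ ≤ ∫ x in B, W x * |un n x| ^ p := by
          refine setIntegral_mono_on (hint.const_mul c).integrableOn
            (IntegrableOn.mono_set hWi (subset_closure.trans hBs)) hBo.measurableSet fun x hx => ?_
          exact mul_le_mul_of_nonneg_right (hmin (subset_closure hx)) (by positivity)
      _ ≤ ∫ x in Ω, W x * |un n x| ^ p := by
          refine setIntegral_mono_set hWi ?_ (subset_closure.trans hBs).eventuallyLE
          filter_upwards [ae_restrict_mem hΩ.measurableSet] with x hx
          have := hW0 x hx
          simp only [Pi.zero_apply]
          positivity
  have := ge_of_tendsto hlim (Eventually.of_forall key)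
  linarith


/-- Proposition 13.9 (strict domain monotonicity): let `Ω₁ ⊂ Ω₂` be domains with
`Ω₂ \ closure Ω₁ ≠ ∅`. (1) If `Q_V ≥ 0` on `C_c^∞(Ω₂)`, then `Q_V` is subcritical
in `Ω₁`. (2) If `Q_V` is critical in `Ω₁`, then `Q_V` is supercritical in `Ω₂`. -/
theorem stmt16 (d : ℕ) (p : ℝ) (hp : 1 < p) (Ω₁ Ω₂ : Set (Ed d))
    (hopen₁ : IsOpen Ω₁) (hconn₁ : IsConnected Ω₁)
    (hopen₂ : IsOpen Ω₂) (hconn₂ : IsConnected Ω₂)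
    (hsub : Ω₁ ⊆ Ω₂) (hstrict : (Ω₂ \ closure Ω₁).Nonempty)
    (V : Ed d → ℝ) (hV : LocBddOn Ω₂ V) :
    (NonnegOn p Ω₂ V → SubcriticalOn p Ω₁ V) ∧
    (CriticalOn p Ω₁ V → ∃ u, IsTestOn Ω₂ u ∧ Qp p Ω₂ V u < 0) := by
  have h1 : NonnegOn p Ω₂ V → SubcriticalOn p Ω₁ V := fun hN =>
    part1 hp hconn₁ hopen₂ hconn₂ hsub hstrict hV hN
  refine ⟨h1, fun hc => ?_⟩
  by_contra hcon
  push Not at hcon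
  exact part2 hp hc (h1 hcon) hopen₁
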